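/- Let (X_i,Y_i) be i.i.d. from a finite distribution P with H = H(Y|X), σ² = Var(log P(Y|X)) > 0, ρ = E[|log P(Y|X)+H|³]. For α with α − ρ/(√n σ³) ∈ (0,1), set β = exp(nμ − Q⁻¹(α − ρ/(√n σ³))·σ√n) with μ = −H, and define Γ(x₁ⁿ) = {(y₁,...,y_n) : Πᵢ P(yᵢ|xᵢ) ≥ β}. Then P((Y_1,...,Y_n) ∉ Γ(X_1,...,X_n)) ≤ α and (1/n)·log E[|Γ(X_1ⁿ)|] ≤ H + σ·Q⁻¹(α)/√n + O(1/n). -/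

import Mathlib

/-- The standard Gaussian complementary CDF `Q(t) = P(N(0,1) > t)`. -/
noncomputable def gaussQ (t : ℝ) : ℝ :=
  (Real.sqrt (2 * Real.pi))⁻¹ * ∫ u in Set.Ioi t, Real.exp (-u ^ 2 / 2)

section BerryEsseen

open MeasureTheory Set Real

/-- The imaginary part of the Fourier weight of the Beurling majorant of a half-line. -/
noncomputable def beurlingWeight (s : ℝ) : ℝ :=
  (1 - s) * (Real.cos (Real.pi * s) / Real.sin (Real.pi * s)) + 1 / Real.pi

open Real Filter Topology in
theorem tendsto_sum_inv_sq_sub_sq {s : ℝ} (h0 : 0 < s) (h1 : s < 1) :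
    Tendsto (fun n : ℕ => ∑ j ∈ Finset.range n, 2 * s / (((j : ℝ) + 1) ^ 2 - s ^ 2)) atTop
      (𝓝 (1 / s - π * (cos (π * s) / sin (π * s)))) := by
  have hs : (s : ℂ) ∈ Complex.integerComplement := by
    rintro ⟨m, hm⟩
    have hm' : (m : ℝ) = s := by exact_mod_cast hm
    have a : (0 : ℤ) < m := by exact_mod_cast hm' ▸ h0
    have b : m < (1 : ℤ) := by exact_mod_cast hm' ▸ h1
    omega
  have h := (Complex.continuous_re.tendsto _).comp (tendsto_logDeriv_euler_cot_sub hs)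
  have h2 := h.neg
  refine (h2.congr fun n => ?_).trans_eq ?_
  · rw [Function.comp_apply, Complex.re_sum, ← Finset.sum_neg_distrib]
    refine Finset.sum_congr rfl fun j _ => ?_
    rw [cotTerm_identity hs]
    have hj : ((j : ℝ) + 1) ^ 2 - s ^ 2 ≠ 0 := by
      have : (0 : ℝ) ≤ j := Nat.cast_nonneg j
      nlinarith
    have : (2 * (s : ℂ) * (1 / ((s + ((j : ℂ) + 1)) * (s - ((j : ℂ) + 1))))) =
        ((-(2 * s / (((j : ℝ) + 1) ^ 2 - s ^ 2)) : ℝ) : ℂ) := by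
      push_cast
      rw [show ((s : ℂ) + ((j : ℂ) + 1)) * (s - ((j : ℂ) + 1)) = -(((j : ℂ) + 1) ^ 2 - s ^ 2) by
        ring]
      rw [one_div, inv_neg]
      ring
    rw [this, Complex.ofReal_re, neg_neg]
  · have : ((π : ℂ) * Complex.cot (π * s) - 1 / s) =
        ((π * (cos (π * s) / sin (π * s)) - 1 / s : ℝ) : ℂ) := by
      push_cast
      rw [Complex.cot]
    rw [this, Complex.ofReal_re, neg_sub]

open Real Filter Topology in
theorem le_inv_sub_pi_mul_cot {s : ℝ} (h0 : 0 < s) (h1 : s < 1) :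
    π ^ 2 / 3 * s ≤ 1 / s - π * (cos (π * s) / sin (π * s)) := by
  have hz : Tendsto (fun n : ℕ => ∑ j ∈ Finset.range n, 2 * s * (1 / ((j : ℝ) + 1) ^ 2)) atTop
      (𝓝 (2 * s * (π ^ 2 / 6))) := by
    simp_rw [← Finset.mul_sum]
    refine Tendsto.const_mul _ ?_
    have := (hasSum_nat_add_iff' 1).mpr hasSum_zeta_two
    simpa using this.tendsto_sum_nat
  have := le_of_tendsto_of_tendsto' hz (tendsto_sum_inv_sq_sub_sq h0 h1) fun n =>
    Finset.sum_le_sum fun j _ => by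
      have : (0 : ℝ) ≤ j := Nat.cast_nonneg j
      rw [mul_one_div]
      apply div_le_div_of_nonneg_left (by positivity) (by nlinarith) (by nlinarith)
  linarith

open Real Filter Topology in
theorem inv_sub_pi_mul_cot_le {s : ℝ} (h0 : 0 < s) (h1 : s < 1) :
    (1 / s - π * (cos (π * s) / sin (π * s))) * (1 - s ^ 2) ≤ π ^ 2 / 3 * s := by
  have hz : Tendsto (fun n : ℕ => ∑ j ∈ Finset.range n, 2 * s * (1 / ((j : ℝ) + 1) ^ 2)) atTop
      (𝓝 (2 * s * (π ^ 2 / 6))) := by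
    simp_rw [← Finset.mul_sum]
    refine Tendsto.const_mul _ ?_
    have := (hasSum_nat_add_iff' 1).mpr hasSum_zeta_two
    simpa using this.tendsto_sum_nat
  have := le_of_tendsto_of_tendsto' ((tendsto_sum_inv_sq_sub_sq h0 h1).mul_const (1 - s ^ 2)) hz
    fun n => by
      rw [Finset.sum_mul]
      refine Finset.sum_le_sum fun j _ => ?_
      have : (0 : ℝ) ≤ j := Nat.cast_nonneg j
      have hp : 0 < ((j : ℝ) + 1) ^ 2 - s ^ 2 := by nlinarith
      have hp2 : 0 < ((j : ℝ) + 1) ^ 2 := by positivity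
      rw [mul_one_div, div_mul_eq_mul_div, div_le_div_iff₀ hp hp2]
      have : 0 ≤ s ^ 2 * (((j : ℝ) + 1) ^ 2 - 1) := mul_nonneg (by positivity) (by nlinarith)
      nlinarith
  linarith

open Real in
theorem beurlingWeight_eq {s : ℝ} (h0 : 0 < s) :
    beurlingWeight s =
      1 / (π * s) - (1 - s) * ((1 / s - π * (cos (π * s) / sin (π * s))) / π) := by
  unfold beurlingWeight
  field_simp
  ring

open Real in
theorem beurlingWeight_nonneg {s : ℝ} (h0 : 0 < s) (h1 : s < 1) : 0 ≤ beurlingWeight s := by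
  have h := le_inv_sub_pi_mul_cot (s := 1 - s) (by linarith) (by linarith)
  have e1 : π * (1 - s) = π - π * s := by ring
  rw [e1, cos_pi_sub, sin_pi_sub] at h
  have : beurlingWeight s =
      (1 - s) * (1 / (1 - s) - π * (-cos (π * s) / sin (π * s))) / π := by
    unfold beurlingWeight
    have : 1 - s ≠ 0 := by linarith
    field_simp
    ring
  rw [this]
  have : 0 ≤ π ^ 2 / 3 * (1 - s) := mul_nonneg (by positivity) (by linarith)
  exact div_nonneg (mul_nonneg (by linarith) (this.trans h)) pi_pos.le

open Real in
theorem beurlingWeight_le {s : ℝ} (h0 : 0 < s) (h1 : s < 1) :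
    beurlingWeight s ≤ 1 / (π * s) - π / 3 * s * (1 - s) := by
  rw [beurlingWeight_eq h0]
  have h := mul_le_mul_of_nonneg_left
    (div_le_div_of_nonneg_right (le_inv_sub_pi_mul_cot h0 h1) pi_pos.le) (sub_nonneg.2 h1.le)
  have e : (1 - s) * (π ^ 2 / 3 * s / π) = π / 3 * s * (1 - s) := by
    field_simp
  linarith

/-- The modulus of the Fourier weight of the Beurling majorant is at most `1.033 / (π s)`. -/
theorem sq_add_beurlingWeight_sq_le {s : ℝ} (h0 : 0 < s) (h1 : s < 1) :
    (1 - s) ^ 2 + beurlingWeight s ^ 2 ≤ (1.033 / (Real.pi * s)) ^ 2 := by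
  have hp := Real.pi_pos
  have hb := beurlingWeight_le h0 h1
  have hb0 := beurlingWeight_nonneg h0 h1
  have hps : 0 < Real.pi * s := by positivity
  set P := Real.pi ^ 2 with hP
  have h3 : P ≤ 9.8697 := by
    have := Real.pi_lt_d6; rw [hP]; nlinarith
  have h4 : 9.8696 ≤ P := by
    have := Real.pi_gt_d6; rw [hP]; nlinarith
  have h5 : Real.pi * s * beurlingWeight s ≤ 1 - P / 3 * s ^ 2 * (1 - s) := by
    calc _ ≤ Real.pi * s * (1 / (Real.pi * s) - Real.pi / 3 * s * (1 - s)) := by gcongr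
      _ = _ := by rw [hP]; field_simp
  have h6 : (Real.pi * s * beurlingWeight s) ^ 2 ≤ (1 - P / 3 * s ^ 2 * (1 - s)) ^ 2 := by
    gcongr
  rw [div_pow, le_div_iff₀ (by positivity)]
  have h7 : ((1 - s) ^ 2 + beurlingWeight s ^ 2) * (Real.pi * s) ^ 2 =
    P * s ^ 2 * (1 - s) ^ 2 + (Real.pi * s * beurlingWeight s) ^ 2 := by rw [hP]; ring
  rw [h7]
  set z := s ^ 2 * (1 - s) with hz
  have hz0 : 0 ≤ z := mul_nonneg (sq_nonneg _) (by linarith)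
  have hz1 : z ≤ 4 / 27 := by nlinarith [mul_nonneg (by linarith : 0 ≤ s + 1/3) (sq_nonneg (s - 2/3))]
  have e : P * s ^ 2 * (1 - s) ^ 2 + (1 - P / 3 * s ^ 2 * (1 - s)) ^ 2 =
      1 + P * (z * (1 / 3 - s)) + P ^ 2 / 9 * z ^ 2 := by rw [hz]; ring
  have : 1 + P * (z * (1 / 3 - s)) + P ^ 2 / 9 * z ^ 2 ≤ 1.033 ^ 2 := by
    have a1 : P ^ 2 / 9 ≤ 10.8235 := by nlinarith
    have a2 : P ^ 2 / 9 * z ^ 2 ≤ 10.8235 * z ^ 2 := by gcongr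
    have a3 : P * (z * (1 / 3 - s)) ≤ 9.8696 * (z * (1 / 3 - s)) + 0.0001 := by
      have : z * (1/3 - s) ≤ 1 := by nlinarith
      nlinarith
    have a4 : 9.8696 * (z * (1 / 3 - s)) + 10.8235 * z ^ 2 ≤ 0.0669 := by
      rw [hz]
      have h2 := sub_pos.2 h1
      nlinarith [sq_nonneg (s - 0.283), sq_nonneg (s * (s - 0.283)), sq_nonneg (s ^ 2 * (s - 0.283)),
        mul_nonneg h0.le (sq_nonneg (s - 0.283)),
        mul_nonneg h2.le (sq_nonneg (s - 0.283)),
        mul_nonneg (mul_nonneg h0.le h2.le) (sq_nonneg (s - 0.283)),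
        mul_nonneg (mul_nonneg h0.le h2.le) (sq_nonneg (s*(s - 0.283))),
        mul_nonneg (h2.le) (sq_nonneg (s*(s - 0.283))),
        mul_nonneg (h0.le) (sq_nonneg (s*(s - 0.283)))]
    norm_num at *
    linarith
  linarith

open Real in
theorem sq_add_sq_le_gaussian_weight {s : ℝ} (h0 : 0 < s) (h1 : s < 1) :
    (1 - s) ^ 2 + (1 / (π * s) - beurlingWeight s) ^ 2 ≤ (1 - s + 0.55 * s ^ 2) ^ 2 := by
  rw [beurlingWeight_eq h0, sub_sub_cancel]
  have h := inv_sub_pi_mul_cot_le h0 h1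
  have hl := le_inv_sub_pi_mul_cot h0 h1
  set w := 1 / s - π * (cos (π * s) / sin (π * s))
  have hw : 0 ≤ w := le_trans (by positivity) hl
  have hu : (1 - s) * (w / π) ≤ π / 3 * s / (1 + s) := by
    rw [le_div_iff₀ (by linarith)]
    calc _ = w * (1 - s ^ 2) / π := by ring
      _ ≤ π ^ 2 / 3 * s / π := by gcongr
      _ = _ := by field_simp
  have hl : 0 ≤ (1 - s) * (w / π) := mul_nonneg (by linarith) (by positivity)
  have h3 : π ^ 2 ≤ 9.87 := by
    have := Real.pi_lt_d6; nlinarith [Real.pi_pos]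
  have h4 : ((1 - s) * (w / π)) ^ 2 ≤ (π / 3 * s / (1 + s)) ^ 2 := by gcongr
  have h5 : (π / 3 * s / (1 + s)) ^ 2 ≤ s ^ 2 * (1.1 * (1 - s) + 0.3025 * s ^ 2) := by
    rw [div_pow, div_le_iff₀ (by positivity)]
    have h6 : 9.87 / 9 ≤ (1.1 * (1 - s) + 0.3025 * s ^ 2) * (1 + s) ^ 2 := by
      have : 0 ≤ s * (1 - s) := mul_nonneg h0.le (by linarith)
      nlinarith [mul_nonneg this h0.le, mul_nonneg this (by linarith : 0 ≤ 1 - s), mul_nonneg (mul_nonneg this h0.le) h0.le]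
    calc _ = s ^ 2 * (π ^ 2 / 9) := by ring
      _ ≤ s ^ 2 * ((1.1 * (1 - s) + 0.3025 * s ^ 2) * (1 + s) ^ 2) := by gcongr; linarith
      _ = _ := by ring
  nlinarith

open Real MeasureTheory in
/-- The Beurling majorant of the indicator function of `[0, ∞)`. -/
noncomputable def beurlingMajorant (x : ℝ) : ℝ :=
  1 / 2 + ∫ s in (0 : ℝ)..1,
    ((1 - s) * cos (2 * π * x * s) + beurlingWeight s * sin (2 * π * x * s))

theorem measurable_beurlingWeight : Measurable beurlingWeight := by
  unfold beurlingWeight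
  fun_prop

open MeasureTheory Set in
theorem intervalIntegrable_of_measurable_of_bounded {f : ℝ → ℝ} (hf : Measurable f) (C : ℝ)
    (h : ∀ s, 0 < s → s < 1 → |f s| ≤ C) : IntervalIntegrable f volume 0 1 := by
  rw [intervalIntegrable_iff_integrableOn_Ioo_of_le zero_le_one]
  refine Measure.integrableOn_of_bounded (M := C) (by simp) hf.aestronglyMeasurable ?_
  exact (ae_restrict_mem measurableSet_Ioo).mono fun s hs => h s hs.1 hs.2

theorem abs_beurlingWeight_mul_le {s g K : ℝ} (h0 : 0 < s) (h1 : s < 1) (hg : |g| ≤ K * s) :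
    |beurlingWeight s * g| ≤ K := by
  have hp := Real.pi_gt_three
  have hb : beurlingWeight s ≤ 1 / s := by
    refine (beurlingWeight_le h0 h1).trans ?_
    have : 0 ≤ Real.pi / 3 * s * (1 - s) := mul_nonneg (by positivity) (by linarith)
    have h2 : 1 / (Real.pi * s) ≤ 1 / s :=
      one_div_le_one_div_of_le h0 (by nlinarith)
    linarith
  rw [abs_mul, abs_of_nonneg (beurlingWeight_nonneg h0 h1)]
  calc _ ≤ 1 / s * (K * s) := by
        gcongr
    _ = K := by field_simp

theorem intervalIntegrable_beurlingWeight_mul {g : ℝ → ℝ} (hg : Measurable g) (K : ℝ)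
    (h : ∀ s, 0 < s → s < 1 → |g s| ≤ K * s) :
    IntervalIntegrable (fun s => beurlingWeight s * g s) MeasureTheory.volume 0 1 :=
  intervalIntegrable_of_measurable_of_bounded (measurable_beurlingWeight.mul hg) K
    fun s h0 h1 => abs_beurlingWeight_mul_le h0 h1 (h s h0 h1)

open Real in
theorem abs_sin_mul_le (c : ℝ) {s : ℝ} (h0 : 0 < s) : |sin (c * s)| ≤ |c| * s := by
  refine abs_sin_le_abs.trans ?_
  rw [abs_mul, abs_of_pos h0]

open Real in
theorem abs_cos_mul_sub_one_le (c : ℝ) {s : ℝ} (h0 : 0 < s) (h1 : s < 1) :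
    |cos (c * s) - 1| ≤ c ^ 2 * s := by
  have := one_sub_sq_div_two_le_cos (x := c * s)
  have h2 := cos_le_one (c * s)
  rw [abs_of_nonpos (by linarith)]
  have : (c * s) ^ 2 / 2 ≤ c ^ 2 * s := by
    have : 0 ≤ c ^ 2 * (s * (1 - s)) :=
      mul_nonneg (sq_nonneg c) (mul_nonneg h0.le (by linarith))
    nlinarith [sq_nonneg c, mul_nonneg (sq_nonneg c) h0.le]
  linarith

open Real in
theorem intervalIntegrable_beurlingMajorant (c : ℝ) :
    IntervalIntegrable (fun s => (1 - s) * cos (c * s) + beurlingWeight s * sin (c * s))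
      MeasureTheory.volume 0 1 :=
  (Continuous.intervalIntegrable (by fun_prop) _ _).add
    (intervalIntegrable_beurlingWeight_mul (by fun_prop) |c| fun s h0 _ => abs_sin_mul_le c h0)

open Real in
theorem integral_sin_mul {c : ℝ} (hc : c ≠ 0) :
    ∫ s in (0 : ℝ)..1, sin (c * s) = (1 - cos c) / c := by
  rw [intervalIntegral.integral_comp_mul_left _ hc, integral_sin]
  simp
  field_simp

open Real in
theorem integral_two_mul_one_sub_mul_cos {c : ℝ} (hc : c ≠ 0) :
    ∫ s in (0 : ℝ)..1, 2 * (1 - s) * cos (c * s) = 2 * (1 - cos c) / c ^ 2 := by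
  have h : ∀ s ∈ Set.uIcc (0 : ℝ) 1, HasDerivAt
      (fun s => 2 * (1 - s) * (sin (c * s) / c) - 2 * cos (c * s) / c ^ 2)
      (2 * (1 - s) * cos (c * s)) s := by
    intro s _
    have h1 : HasDerivAt (fun s : ℝ => c * s) c s := by
      simpa using (hasDerivAt_id s).const_mul c
    have h2 := ((((hasDerivAt_id s).const_sub 1).const_mul 2).mul (h1.sin.div_const c)).sub
      ((h1.cos.const_mul 2).div_const (c ^ 2))
    refine h2.congr_deriv ?_
    simp
    field_simp
    ring
  rw [intervalIntegral.integral_eq_sub_of_hasDerivAt h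
    (Continuous.intervalIntegrable (by fun_prop) _ _)]
  simp
  ring

open Real in
theorem beurlingMajorant_sub (x : ℝ) :
    beurlingMajorant x - beurlingMajorant (x - 1) =
      (∫ s in (0 : ℝ)..1, 2 * (1 - s) * cos (2 * π * x * s)) +
        1 / π * ((∫ s in (0 : ℝ)..1, sin (2 * π * x * s)) -
          ∫ s in (0 : ℝ)..1, sin (2 * π * (x - 1) * s)) := by
  unfold beurlingMajorant
  rw [add_sub_add_left_eq_sub,
    ← intervalIntegral.integral_sub (intervalIntegrable_beurlingMajorant _)
      (intervalIntegrable_beurlingMajorant _),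
    ← intervalIntegral.integral_sub (Continuous.intervalIntegrable (by fun_prop) _ _)
      (Continuous.intervalIntegrable (by fun_prop) _ _),
    ← intervalIntegral.integral_const_mul,
    ← intervalIntegral.integral_add (Continuous.intervalIntegrable (by fun_prop) _ _)
      (Continuous.intervalIntegrable (by fun_prop) _ _)]
  refine intervalIntegral.integral_congr_Ioo_of_le zero_le_one fun s hs => ?_
  have hsin : sin (π * s) ≠ 0 :=
    (sin_pos_of_pos_of_lt_pi (mul_pos pi_pos hs.1) (by nlinarith [pi_pos, hs.2])).ne'
  set a := 2 * π * x * s - π * s with ha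
  have e1 : 2 * π * x * s = a + π * s := by rw [ha]; ring
  have e2 : 2 * π * (x - 1) * s = a - π * s := by rw [ha]; ring
  simp only [e1, e2, cos_add, cos_sub, sin_add, sin_sub]
  unfold beurlingWeight
  generalize sin (π * s) = S at hsin ⊢
  field_simp
  ring

open Real in
theorem beurlingMajorant_sub_of_ne {x : ℝ} (hx : x ≠ 0) (hx1 : x ≠ 1) :
    beurlingMajorant x - beurlingMajorant (x - 1) =
      (1 - cos (2 * π * x)) / (2 * π ^ 2) * (1 / x ^ 2 - 1 / (x * (x - 1))) := by
  have hp := pi_ne_zero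
  have h1 : x - 1 ≠ 0 := sub_ne_zero.2 hx1
  rw [beurlingMajorant_sub, integral_two_mul_one_sub_mul_cos (by positivity),
    integral_sin_mul (by positivity), integral_sin_mul (by positivity),
    show 2 * π * (x - 1) = 2 * π * x - 2 * π by ring, cos_sub_two_pi]
  rw [show 2 * π * x - 2 * π = 2 * π * (x - 1) by ring]
  field_simp
  ring

theorem beurlingMajorant_zero : beurlingMajorant 0 = 1 := by
  unfold beurlingMajorant
  have h : ∫ s in (0 : ℝ)..1, (1 - s) = 1 / 2 := by
    rw [intervalIntegral.integral_sub (by simp) (by simp)]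
    norm_num
  simp only [mul_zero, zero_mul, Real.cos_zero, Real.sin_zero, mul_one, add_zero, h]
  norm_num

theorem beurlingMajorant_natCast (N : ℕ) : beurlingMajorant N = 1 := by
  induction N with
  | zero => simpa using beurlingMajorant_zero
  | succ N ih =>
    rw [← ih, ← sub_eq_zero]
    rcases Nat.eq_zero_or_pos N with rfl | hN
    · have h := beurlingMajorant_sub 1
      rw [integral_two_mul_one_sub_mul_cos (by simp [Real.pi_ne_zero]),
        integral_sin_mul (by simp [Real.pi_ne_zero])] at h
      simpa using h
    · have h := beurlingMajorant_sub_of_ne (x := (N : ℝ) + 1) (by positivity)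
        (by simpa using hN.ne')
      rw [add_sub_cancel_right] at h
      push_cast
      rw [h, show 2 * Real.pi * ((N : ℝ) + 1) = ((N + 1 : ℕ) : ℝ) * (2 * Real.pi) by
        push_cast; ring, Real.cos_nat_mul_two_pi]
      simp

theorem beurlingMajorant_neg_natCast (N : ℕ) : beurlingMajorant (-(N : ℝ) - 1) = 0 := by
  induction N with
  | zero =>
    have h := beurlingMajorant_sub 0
    rw [zero_sub, beurlingMajorant_zero, integral_sin_mul (c := 2 * Real.pi * -1)
      (by simp [Real.pi_ne_zero])] at h
    have h2 : ∫ s in (0 : ℝ)..1, 2 * (1 - s) = 1 := by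
      rw [intervalIntegral.integral_const_mul, intervalIntegral.integral_sub (by simp) (by simp)]
      norm_num
    simp [h2] at h
    simpa using h
  | succ N ih =>
    have h := beurlingMajorant_sub_of_ne (x := -(N : ℝ) - 1)
      (by have : (0 : ℝ) ≤ N := N.cast_nonneg
          intro h; linarith) (by have : (0 : ℝ) ≤ N := N.cast_nonneg
                                 intro h; linarith)
    rw [show 2 * Real.pi * (-(N : ℝ) - 1) = -(((N + 1 : ℕ) : ℝ) * (2 * Real.pi)) by
        push_cast; ring, Real.cos_neg, Real.cos_nat_mul_two_pi, ih] at h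
    push_cast
    rw [show -((N : ℝ) + 1) - 1 = -(N : ℝ) - 1 - 1 by ring]
    simpa using h

open Real Filter Topology MeasureTheory FourierTransform in
theorem tendsto_beurlingMajorant_add_sub (x : ℝ) :
    Tendsto (fun w => beurlingMajorant (x + w) - beurlingMajorant w) (cocompact ℝ) (𝓝 0) := by
  set c := 2 * π * x with hc
  set a : ℝ → ℝ := fun s => (1 - s) * (cos (c * s) - 1) + beurlingWeight s * sin (c * s) with ha
  set b : ℝ → ℝ := fun s => -((1 - s) * sin (c * s)) + beurlingWeight s * (cos (c * s) - 1) with hb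
  have ia : IntervalIntegrable a volume 0 1 :=
    (Continuous.intervalIntegrable (by fun_prop) _ _).add
      (intervalIntegrable_beurlingWeight_mul (by fun_prop) |c| fun s h0 _ => abs_sin_mul_le c h0)
  have ib : IntervalIntegrable b volume 0 1 :=
    (Continuous.intervalIntegrable (by fun_prop) _ _).add
      (intervalIntegrable_beurlingWeight_mul (by fun_prop) (c ^ 2)
        fun s h0 h1 => abs_cos_mul_sub_one_le c h0 h1)
  have key := Real.tendsto_integral_exp_smul_cocompact
    ((Set.Ioc (0 : ℝ) 1).indicator fun s => (a s : ℂ) + b s * Complex.I)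
  have key2 := (Complex.continuous_re.tendsto _).comp key
  rw [Complex.zero_re] at key2
  refine key2.congr fun w => ?_
  have iab : Integrable (fun s => (a s : ℂ) + b s * Complex.I)
      (volume.restrict (Set.Ioc (0 : ℝ) 1)) :=
    ia.1.ofReal.add (ib.1.ofReal.mul_const _)
  simp only [Function.comp_apply]
  have e : (fun v => 𝐞 (-(v * w)) •
      (Set.Ioc (0 : ℝ) 1).indicator (fun s => (a s : ℂ) + b s * Complex.I) v) =
      (Set.Ioc (0 : ℝ) 1).indicator
        (fun v => 𝐞 (-(v * w)) • ((a v : ℂ) + b v * Complex.I)) := by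
    ext v
    by_cases hv : v ∈ Set.Ioc (0 : ℝ) 1 <;> simp [hv]
  have i2 : Integrable (fun v => 𝐞 (-(v * w)) • ((a v : ℂ) + b v * Complex.I))
      (volume.restrict (Set.Ioc (0 : ℝ) 1)) := by
    refine (integrable_norm_iff ?_).1 ?_
    · refine AEStronglyMeasurable.smul (f := fun v : ℝ => 𝐞 (-(v * w))) ?_ iab.1
      exact Continuous.aestronglyMeasurable (by fun_prop)
    · simpa only [Circle.norm_smul] using iab.norm
  rw [e, integral_indicator measurableSet_Ioc]
  refine (integral_re i2).symm.trans ?_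
  unfold beurlingMajorant
  rw [add_sub_add_left_eq_sub,
    ← intervalIntegral.integral_sub (intervalIntegrable_beurlingMajorant _)
      (intervalIntegrable_beurlingMajorant _), intervalIntegral.integral_of_le zero_le_one]
  refine integral_congr_ae (ae_of_all _ fun v => ?_)
  simp only [Circle.smul_def, Real.fourierChar_apply, smul_eq_mul, RCLike.re_eq_complex_re,
    Complex.mul_re, Complex.exp_ofReal_mul_I_re, Complex.exp_ofReal_mul_I_im, Complex.add_re,
    Complex.add_im, Complex.ofReal_re, Complex.ofReal_im, Complex.mul_im, Complex.I_re,
    Complex.I_im]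
  rw [show 2 * π * (x + w) * v = c * v + 2 * π * w * v by rw [hc]; ring,
    show 2 * π * -(v * w) = -(2 * π * w * v) by ring, cos_add, sin_add, cos_neg, sin_neg]
  simp only [ha, hb]
  ring

theorem beurlingMajorant_nonneg_of_neg {x : ℝ} (hx : x < 0) : 0 ≤ beurlingMajorant x := by
  have hstep : ∀ y < 0, beurlingMajorant (y - 1) ≤ beurlingMajorant y := by
    intro y hy
    rw [← sub_nonneg, beurlingMajorant_sub_of_ne hy.ne (by linarith)]
    refine mul_nonneg (div_nonneg (by linarith [Real.cos_le_one (2 * Real.pi * y)])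
      (by positivity)) (sub_nonneg.2 ?_)
    apply one_div_le_one_div_of_le <;> nlinarith
  have hmono : ∀ N : ℕ, beurlingMajorant (x + (-(N : ℝ) - 1)) ≤ beurlingMajorant x := by
    intro N
    induction N with
    | zero => simpa [← sub_eq_add_neg] using hstep x hx
    | succ N ih =>
      refine le_trans ?_ ih
      have hN : (0 : ℝ) ≤ N := N.cast_nonneg
      have := hstep (x + (-(N : ℝ) - 1)) (by linarith)
      push_cast
      rwa [show x + (-((N : ℝ) + 1) - 1) = x + (-(N : ℝ) - 1) - 1 by ring]
  have ht : Filter.Tendsto (fun N : ℕ => -(N : ℝ) - 1) Filter.atTop (Filter.cocompact ℝ) :=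
    (Filter.tendsto_atBot_add_const_right _ _
      (Filter.tendsto_neg_atTop_atBot.comp tendsto_natCast_atTop_atTop)).mono_right
      atBot_le_cocompact
  have hlim := (tendsto_beurlingMajorant_add_sub x).comp ht
  refine le_of_tendsto' hlim fun N => ?_
  simp only [Function.comp_apply, beurlingMajorant_neg_natCast, sub_zero]
  exact hmono N

theorem one_le_beurlingMajorant {x : ℝ} (hx : 0 ≤ x) : 1 ≤ beurlingMajorant x := by
  rcases hx.eq_or_lt with rfl | hx
  · exact beurlingMajorant_zero.ge
  have hstep : ∀ y > 0, beurlingMajorant (y + 1) ≤ beurlingMajorant y := by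
    intro y hy
    have h := beurlingMajorant_sub_of_ne (x := y + 1) (by linarith) (by linarith)
    rw [add_sub_cancel_right] at h
    rw [← sub_nonpos, h]
    refine mul_nonpos_of_nonneg_of_nonpos
      (div_nonneg (by linarith [Real.cos_le_one (2 * Real.pi * (y + 1))])
      (by positivity)) (sub_nonpos.2 ?_)
    apply one_div_le_one_div_of_le <;> nlinarith
  have hmono : ∀ N : ℕ, beurlingMajorant (x + N) ≤ beurlingMajorant x := by
    intro N
    induction N with
    | zero => simp
    | succ N ih =>
      refine le_trans ?_ ih
      have := hstep (x + N) (by positivity)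
      push_cast
      rwa [← add_assoc]
  have ht : Filter.Tendsto (fun N : ℕ => (N : ℝ)) Filter.atTop (Filter.cocompact ℝ) :=
    tendsto_natCast_atTop_atTop.mono_right atTop_le_cocompact
  have hlim := ((tendsto_beurlingMajorant_add_sub x).comp ht).add_const 1
  rw [zero_add] at hlim
  refine le_of_tendsto' hlim fun N => ?_
  simp only [Function.comp_apply, beurlingMajorant_natCast, sub_add_cancel]
  exact hmono N

theorem integrable_exp_neg_sq_div_two : Integrable fun u : ℝ => rexp (-u ^ 2 / 2) := by
  refine (integrable_exp_neg_mul_sq (b := 1 / 2) (by norm_num)).congr (ae_of_all _ fun u => ?_)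
  simp only
  ring_nf

theorem integral_Ioi_exp_neg_sq_div_two :
    ∫ u in Ioi (0 : ℝ), rexp (-u ^ 2 / 2) = √(2 * π) / 2 := by
  have h := integral_gaussian_Ioi (1 / 2)
  rw [show π / (1 / 2) = 2 * π by ring] at h
  rw [← h]
  congr 1
  ext u
  ring_nf

theorem gaussQ_eq_sub_intervalIntegral (a : ℝ) :
    gaussQ a = 1 / 2 - (√(2 * π))⁻¹ * ∫ u in (0 : ℝ)..a, rexp (-u ^ 2 / 2) := by
  have h := intervalIntegral.integral_Ioi_sub_Ioi' (a := 0) (b := a) (μ := volume)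
    integrable_exp_neg_sq_div_two.integrableOn integrable_exp_neg_sq_div_two.integrableOn
  rw [integral_Ioi_exp_neg_sq_div_two] at h
  unfold gaussQ
  rw [← h]
  field_simp
  ring

theorem integral_Ioi_cos_mul_exp (a : ℝ) :
    ∫ t in Ioi (0 : ℝ), cos (a * t) * rexp (-t ^ 2 / 2) = √(2 * π) / 2 * rexp (-a ^ 2 / 2) := by
  have h := fourierIntegral_gaussian (b := 1 / 2) (by norm_num) a
  have h2 : Integrable fun x : ℝ => Complex.exp (Complex.I * a * x) *
      Complex.exp (-(1 / 2) * (x : ℂ) ^ 2) := by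
    refine (integrable_cexp_quadratic (b := 1 / 2) (by norm_num) (Complex.I * a) 0).congr
      (ae_of_all _ fun u => ?_)
    simp only [← Complex.exp_add]
    ring_nf
  have h3 := congrArg Complex.re h
  have h4 := (integral_re h2).symm
  simp only [RCLike.re_eq_complex_re] at h4
  rw [h4] at h3
  have h5 := integral_comp_abs (f := fun t => cos (a * t) * rexp (-t ^ 2 / 2))
  have h6 : (fun x : ℝ => (Complex.exp (Complex.I * a * x) *
      Complex.exp (-(1 / 2) * (x : ℂ) ^ 2)).re) =
      fun x => cos (a * |x|) * rexp (-|x| ^ 2 / 2) := by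
    ext x
    have e1 : Complex.I * a * x = ((a * x : ℝ) : ℂ) * Complex.I := by push_cast; ring
    have e2 : (-(1 / 2) * (x : ℂ) ^ 2) = ((-x ^ 2 / 2 : ℝ) : ℂ) := by push_cast; ring
    rw [e1, e2, ← Complex.ofReal_exp, Complex.re_mul_ofReal, Complex.exp_ofReal_mul_I_re, sq_abs]
    rcases abs_choice x with hx | hx <;> simp [hx]
  have h7 : (((π : ℂ) / (1 / 2)) ^ (1 / 2 : ℂ) * Complex.exp (-(a : ℂ) ^ 2 / (4 * (1 / 2)))).re =
      √(2 * π) * rexp (-a ^ 2 / 2) := by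
    have e1 : ((π : ℂ) / (1 / 2)) ^ (1 / 2 : ℂ) = ((√(2 * π) : ℝ) : ℂ) := by
      rw [sqrt_eq_rpow, Complex.ofReal_cpow (by positivity)]
      congr 1 <;> push_cast <;> ring
    have e2 : -(a : ℂ) ^ 2 / (4 * (1 / 2)) = ((-a ^ 2 / 2 : ℝ) : ℂ) := by push_cast; ring
    rw [e1, e2, ← Complex.ofReal_exp, ← Complex.ofReal_mul, Complex.ofReal_re]
  rw [h6, h7, h5] at h3
  linarith

theorem integral_cos_mul {c : ℝ} (hc : c ≠ 0) (a : ℝ) :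
    ∫ u in (0 : ℝ)..a, cos (u * c) = sin (a * c) / c := by
  rw [intervalIntegral.integral_comp_mul_right _ hc, integral_cos]
  simp
  field_simp

theorem integral_Ioi_sin_div_mul_exp (a : ℝ) :
    ∫ t in Ioi (0 : ℝ), sin (a * t) / t * rexp (-t ^ 2 / 2) =
      √(2 * π) / 2 * ∫ u in (0 : ℝ)..a, rexp (-u ^ 2 / 2) := by
  have hfin : IsFiniteMeasure (volume.restrict (uIoc 0 a)) := ⟨by simp [uIoc]⟩
  have hint : Integrable (Function.uncurry fun u t : ℝ => cos (u * t) * rexp (-t ^ 2 / 2))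
      ((volume.restrict (uIoc 0 a)).prod (volume.restrict (Ioi 0))) := by
    have h1 : Integrable (fun z : ℝ × ℝ => (1 : ℝ) * rexp (-z.2 ^ 2 / 2))
        ((volume.restrict (uIoc 0 a)).prod (volume.restrict (Ioi 0))) :=
      Integrable.mul_prod (f := fun _ : ℝ => (1 : ℝ)) (integrable_const _)
        integrable_exp_neg_sq_div_two.integrableOn
    refine h1.mono' (Continuous.aestronglyMeasurable (by fun_prop)) (ae_of_all _ fun z => ?_)
    simp only [Function.uncurry, norm_mul, norm_eq_abs, abs_exp]
    gcongr
    exact abs_cos_le_one _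
  have h := intervalIntegral_integral_swap hint
  simp only [integral_Ioi_cos_mul_exp] at h
  rw [← intervalIntegral.integral_const_mul, h]
  refine setIntegral_congr_fun measurableSet_Ioi fun t ht => ?_
  rw [intervalIntegral.integral_mul_const, integral_cos_mul (ne_of_gt ht)]

theorem gaussQ_eq_integral_sin (a : ℝ) {T : ℝ} (hT : 0 < T) :
    gaussQ a = 1 / 2 -
      ∫ s in Ioi (0 : ℝ), sin (T * s * a) / (π * s) * rexp (-(T * s) ^ 2 / 2) := by
  have h := integral_comp_mul_left_Ioi'
    (fun t => sin (a * t) / t * rexp (-t ^ 2 / 2)) 0 hT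
  rw [mul_zero, integral_Ioi_sin_div_mul_exp] at h
  have h2 : (∫ s in Ioi (0 : ℝ), sin (T * s * a) / (π * s) * rexp (-(T * s) ^ 2 / 2)) =
      π⁻¹ * (T • ∫ s in Ioi (0 : ℝ), sin (a * (T * s)) / (T * s) * rexp (-(T * s) ^ 2 / 2)) := by
    rw [← integral_smul, ← integral_const_mul]
    refine setIntegral_congr_fun measurableSet_Ioi fun s hs => ?_
    simp only [smul_eq_mul]
    have : s ≠ 0 := ne_of_gt hs
    rw [show T * s * a = a * (T * s) by ring]
    field_simp
  rw [h2, h, gaussQ_eq_sub_intervalIntegral]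
  have h3 : (√(2 * π)) ^ 2 = 2 * π := sq_sqrt (by positivity)
  have h4 : (√(2 * π))⁻¹ = π⁻¹ * (√(2 * π) / 2) := by
    field_simp
    linarith
  rw [h4, mul_assoc]

theorem integral_Ioi_pow_mul_exp_neg_mul_sq (k : ℕ) {c : ℝ} (hc : 0 < c) :
    ∫ t in Ioi (0 : ℝ), t ^ k * rexp (-c * t ^ 2) =
      c ^ (-((k : ℝ) + 1) / 2) * (1 / 2) * Gamma (((k : ℝ) + 1) / 2) := by
  rw [← integral_rpow_mul_exp_neg_mul_rpow (p := 2) (q := k) two_pos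
    (by linarith [(Nat.cast_nonneg k : (0 : ℝ) ≤ k)]) hc]
  simp

theorem integrableOn_Ioi_pow_mul_exp_neg_mul_sq (k : ℕ) {c : ℝ} (hc : 0 < c) :
    IntegrableOn (fun t : ℝ => t ^ k * rexp (-c * t ^ 2)) (Ioi 0) := by
  simpa using integrableOn_rpow_mul_exp_neg_mul_sq hc (s := k)
    (by linarith [(Nat.cast_nonneg k : (0 : ℝ) ≤ k)])

theorem integral_Ioi_mul_exp_neg_mul_sq {c : ℝ} (hc : 0 < c) :
    ∫ t in Ioi (0 : ℝ), t ^ 1 * rexp (-c * t ^ 2) = 1 / (2 * c) := by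
  rw [integral_Ioi_pow_mul_exp_neg_mul_sq 1 hc, Nat.cast_one,
    show (-(1 + 1) / 2 : ℝ) = -1 by norm_num, show ((1 + 1) / 2 : ℝ) = 1 by norm_num,
    Gamma_one, rpow_neg_one]
  field_simp

theorem integral_Ioi_sq_mul_exp_neg_mul_sq {c : ℝ} (hc : 0 < c) :
    ∫ t in Ioi (0 : ℝ), t ^ 2 * rexp (-c * t ^ 2) = √π / (4 * (c * √c)) := by
  have hg : Gamma (3 / 2) = √π / 2 := by
    rw [show (3 / 2 : ℝ) = 1 / 2 + 1 by norm_num, Gamma_add_one (by norm_num), Gamma_one_half_eq]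
    ring
  rw [integral_Ioi_pow_mul_exp_neg_mul_sq 2 hc, Nat.cast_ofNat,
    show (-(2 + 1) / 2 : ℝ) = -(1 + 1 / 2) by norm_num, show ((2 + 1) / 2 : ℝ) = 3 / 2 by norm_num,
    hg, rpow_neg hc.le, rpow_add hc, rpow_one, ← sqrt_eq_rpow]
  field_simp
  norm_num

theorem integral_Ioi_cube_mul_exp_neg_mul_sq {c : ℝ} (hc : 0 < c) :
    ∫ t in Ioi (0 : ℝ), t ^ 3 * rexp (-c * t ^ 2) = 1 / (2 * c ^ 2) := by
  rw [integral_Ioi_pow_mul_exp_neg_mul_sq 3 hc, Nat.cast_ofNat,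
    show (-(3 + 1) / 2 : ℝ) = -(2 : ℕ) by norm_num, show ((3 + 1) / 2 : ℝ) = 2 by norm_num,
    Gamma_two, rpow_neg hc.le, rpow_natCast]
  field_simp

theorem integral_Ioi_pow_four_mul_exp_neg_mul_sq {c : ℝ} (hc : 0 < c) :
    ∫ t in Ioi (0 : ℝ), t ^ 4 * rexp (-c * t ^ 2) = 3 * √π / (8 * (c ^ 2 * √c)) := by
  have hg : Gamma (5 / 2) = 3 * √π / 4 := by
    rw [show (5 / 2 : ℝ) = 1 / 2 + 1 + 1 by norm_num, Gamma_add_one (by norm_num),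
      Gamma_add_one (by norm_num), Gamma_one_half_eq]
    ring
  rw [integral_Ioi_pow_mul_exp_neg_mul_sq 4 hc, Nat.cast_ofNat,
    show (-(4 + 1) / 2 : ℝ) = -((2 : ℕ) + 1 / 2) by norm_num,
    show ((4 + 1) / 2 : ℝ) = 5 / 2 by norm_num,
    hg, rpow_neg hc.le, rpow_add hc, rpow_natCast, ← sqrt_eq_rpow]
  field_simp
  norm_num

theorem abs_mul_cos_add_mul_sin_le {u v w : ℝ} (θ : ℝ) (hw : 0 ≤ w) (h : u ^ 2 + v ^ 2 ≤ w ^ 2) :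
    u * cos θ + v * sin θ ≤ w := by
  refine (abs_le_of_sq_le_sq' ?_ hw).2
  nlinarith [sq_nonneg (u * sin θ - v * cos θ), sin_sq_add_cos_sq θ]

theorem integral_Ioi_gaussian_weight {T : ℝ} (hT : 0 < T) :
    IntegrableOn (fun s : ℝ => (1 - s + 0.55 * s ^ 2) * rexp (-(T * s) ^ 2 / 2)) (Ioi 0) ∧
    ∫ s in Ioi (0 : ℝ), (1 - s + 0.55 * s ^ 2) * rexp (-(T * s) ^ 2 / 2) =
      1 / T * (√(2 * π) / 2 * (1 + 0.55 / T ^ 2) - 1 / T) := by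
  have hc : 0 < T ^ 2 / 2 := by positivity
  have i0 := integrableOn_Ioi_pow_mul_exp_neg_mul_sq 0 hc
  have i1 := integrableOn_Ioi_pow_mul_exp_neg_mul_sq 1 hc
  have i2 := integrableOn_Ioi_pow_mul_exp_neg_mul_sq 2 hc
  have e : (fun s : ℝ => (1 - s + 0.55 * s ^ 2) * rexp (-(T * s) ^ 2 / 2)) =
      fun s => (s ^ 0 * rexp (-(T ^ 2 / 2) * s ^ 2) - s ^ 1 * rexp (-(T ^ 2 / 2) * s ^ 2)) +
        0.55 * (s ^ 2 * rexp (-(T ^ 2 / 2) * s ^ 2)) := by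
    ext s
    rw [show -(T * s) ^ 2 / 2 = -(T ^ 2 / 2) * s ^ 2 by ring]
    ring
  rw [e]
  have i01 : IntegrableOn (fun s : ℝ => s ^ 0 * rexp (-(T ^ 2 / 2) * s ^ 2) -
      s ^ 1 * rexp (-(T ^ 2 / 2) * s ^ 2)) (Ioi 0) := i0.sub i1
  refine ⟨i01.add (i2.const_mul _), ?_⟩
  rw [integral_add i01 (i2.const_mul _), integral_sub i0 i1, integral_const_mul,
    integral_Ioi_mul_exp_neg_mul_sq hc, integral_Ioi_sq_mul_exp_neg_mul_sq hc]
  simp only [pow_zero, one_mul]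
  rw [integral_gaussian_Ioi]
  have e1 : √(π / (T ^ 2 / 2)) = √(2 * π) / T := by
    rw [show π / (T ^ 2 / 2) = 2 * π / T ^ 2 by field_simp, sqrt_div (by positivity),
      sqrt_sq hT.le]
  have e2 : √π / (4 * (T ^ 2 / 2 * √(T ^ 2 / 2))) = √(2 * π) / (2 * T ^ 3) := by
    rw [sqrt_div (by positivity), sqrt_sq hT.le, sqrt_mul (by norm_num)]
    have : √2 ≠ 0 := by positivity
    field_simp
    ring
  rw [e1, e2]
  field_simp
  ring

theorem one_div_pi_mul_le_gaussian_weight {s : ℝ} (hs : 1 ≤ s) :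
    1 / (π * s) ≤ 1 - s + 0.55 * s ^ 2 := by
  have hp := pi_gt_three
  have h1 : 1 / (π * s) ≤ 1 / (3 * s) := one_div_le_one_div_of_le (by positivity) (by nlinarith)
  refine h1.trans ?_
  rw [div_le_iff₀ (by positivity)]
  nlinarith [mul_nonneg (sub_nonneg.2 hs) (sub_nonneg.2 hs),
    mul_nonneg (mul_nonneg (sub_nonneg.2 hs) (sub_nonneg.2 hs)) (sub_nonneg.2 hs)]

theorem gaussian_smoothing_le (a : ℝ) {T : ℝ} (hT : 0 < T) :
    1 / 2 + ∫ s in (0 : ℝ)..1, ((1 - s) * (rexp (-(T * s) ^ 2 / 2) * cos (T * s * a)) -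
        beurlingWeight s * (rexp (-(T * s) ^ 2 / 2) * sin (T * s * a))) ≤
      gaussQ a + 1 / T * (√(2 * π) / 2 * (1 + 0.55 / T ^ 2) - 1 / T) := by
  obtain ⟨hwi, hw⟩ := integral_Ioi_gaussian_weight hT
  rw [← hw, gaussQ_eq_integral_sin a hT]
  set γ : ℝ → ℝ := fun s => rexp (-(T * s) ^ 2 / 2) with hγ
  have hγ1 : ∀ s, |γ s| ≤ 1 := fun s => by
    rw [hγ, abs_exp, exp_le_one_iff]
    have := sq_nonneg (T * s)
    linarith
  have hsin_le : ∀ s, 0 < s → |γ s * sin (T * s * a)| ≤ |T * a| * s := fun s hs => by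
    rw [abs_mul, show T * s * a = T * a * s by ring]
    calc |γ s| * |sin (T * a * s)| ≤ 1 * (|T * a| * s) :=
          mul_le_mul (hγ1 s) (abs_sin_mul_le _ hs) (abs_nonneg _) zero_le_one
      _ = _ := one_mul _
  have hfi : IntervalIntegrable (fun s => (1 - s) * (γ s * cos (T * s * a)) -
      beurlingWeight s * (γ s * sin (T * s * a))) volume 0 1 :=
    (Continuous.intervalIntegrable (by fun_prop) _ _).sub
      (intervalIntegrable_beurlingWeight_mul (by fun_prop) |T * a| fun s h0 _ => hsin_le s h0)
  have hsi : IntegrableOn (fun s => sin (T * s * a) / (π * s) * γ s) (Ioi 0) := by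
    have hmaj : IntegrableOn (fun s => |T * a| / π * γ s) (Ioi 0) := by
      refine Integrable.const_mul ?_ _
      have := integrableOn_Ioi_pow_mul_exp_neg_mul_sq 0 (show 0 < T ^ 2 / 2 by positivity)
      refine this.congr_fun (fun s _ => ?_) measurableSet_Ioi
      simp only [hγ]
      ring_nf
    refine Integrable.mono' hmaj (Measurable.aestronglyMeasurable (by fun_prop)) ?_
    refine (ae_restrict_mem measurableSet_Ioi).mono fun s (hs : 0 < s) => ?_
    have h := abs_sin_mul_le (T * a) hs
    rw [norm_eq_abs, abs_mul, abs_div, abs_of_pos (show 0 < π * s by positivity),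
      show T * s * a = T * a * s by ring, abs_of_pos (show 0 < γ s from exp_pos _)]
    refine mul_le_mul_of_nonneg_right ?_ (exp_pos _).le
    rw [div_le_div_iff₀ (by positivity) pi_pos]
    nlinarith [pi_pos]
  have hIoc : Ioc (0 : ℝ) 1 ⊆ Ioi 0 := fun s hs => hs.1
  have hIoi : Ioi (1 : ℝ) ⊆ Ioi 0 := fun s (hs : 1 < s) => zero_lt_one.trans hs
  have hdisj : Disjoint (Ioc (0 : ℝ) 1) (Ioi 1) := Ioc_disjoint_Ioi le_rfl
  rw [← Ioc_union_Ioi_eq_Ioi (zero_le_one (α := ℝ)),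
    setIntegral_union hdisj measurableSet_Ioi (hsi.mono_set hIoc) (hsi.mono_set hIoi),
    setIntegral_union hdisj measurableSet_Ioi (hwi.mono_set hIoc) (hwi.mono_set hIoi),
    intervalIntegral.integral_of_le zero_le_one]
  have hfi' := hfi.1
  have hA : (∫ s in Ioc (0 : ℝ) 1, ((1 - s) * (γ s * cos (T * s * a)) -
        beurlingWeight s * (γ s * sin (T * s * a)))) +
      ∫ s in Ioc (0 : ℝ) 1, sin (T * s * a) / (π * s) * γ s ≤
      ∫ s in Ioc (0 : ℝ) 1, (1 - s + 0.55 * s ^ 2) * γ s := by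
    rw [← integral_add hfi' (hsi.mono_set hIoc), integral_Ioc_eq_integral_Ioo,
      integral_Ioc_eq_integral_Ioo]
    refine setIntegral_mono_on ((hfi'.add (hsi.mono_set hIoc)).mono_set Ioo_subset_Ioc_self)
      (hwi.mono_set fun s hs => hs.1) measurableSet_Ioo fun s hs => ?_
    have h := abs_mul_cos_add_mul_sin_le (T * s * a)
      (by nlinarith [sq_nonneg (s - 1)]) (sq_add_sq_le_gaussian_weight hs.1 hs.2)
    have hpos : 0 ≤ γ s := (exp_pos _).le
    calc _ = ((1 - s) * cos (T * s * a) + (1 / (π * s) - beurlingWeight s) * sin (T * s * a)) *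
          γ s := by ring
      _ ≤ _ := mul_le_mul_of_nonneg_right h hpos
  have hB : ∫ s in Ioi (1 : ℝ), sin (T * s * a) / (π * s) * γ s ≤
      ∫ s in Ioi (1 : ℝ), (1 - s + 0.55 * s ^ 2) * γ s := by
    refine setIntegral_mono_on (hsi.mono_set hIoi) (hwi.mono_set hIoi) measurableSet_Ioi
      fun s hs => mul_le_mul_of_nonneg_right ?_ (exp_pos _).le
    have hs0 : 0 < s := hIoi hs
    refine le_trans ?_ (one_div_pi_mul_le_gaussian_weight (le_of_lt hs))
    gcongr
    exact sin_le_one _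
  linarith

open Complex in
theorem re_im_smoothing (κ : Type*) [Fintype κ] (p W : κ → ℝ) (a t u v : ℝ) :
    ∑ f, p f * (u * Real.cos (t * (W f - a)) + v * Real.sin (t * (W f - a))) =
      u * (Real.exp (-t ^ 2 / 2) * Real.cos (t * a)) -
        v * (Real.exp (-t ^ 2 / 2) * Real.sin (t * a)) +
      ((u - v * I) * cexp (-(t * a : ℝ) * I) *
        (∑ f, p f * cexp ((t * W f : ℝ) * I) - Real.exp (-t ^ 2 / 2))).re := by
  rw [mul_sub, sub_re, Finset.mul_sum, re_sum]
  have h1 : ((u - v * I) * cexp (-(t * a : ℝ) * I) * Real.exp (-t ^ 2 / 2)).re =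
      u * (Real.exp (-t ^ 2 / 2) * Real.cos (t * a)) -
        v * (Real.exp (-t ^ 2 / 2) * Real.sin (t * a)) := by
    rw [re_mul_ofReal, ← ofReal_neg, exp_mul_I, ← ofReal_cos, ← ofReal_sin, Real.cos_neg,
      Real.sin_neg]
    simp only [mul_re, add_re, sub_re, mul_im, add_im, sub_im, ofReal_re, ofReal_im, I_re, I_im]
    ring
  rw [h1, add_sub_cancel]
  refine Finset.sum_congr rfl fun f _ => ?_
  have h2 : (u - v * I) * cexp (-(t * a : ℝ) * I) * (p f * cexp ((t * W f : ℝ) * I)) =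
      p f * ((u - v * I) * cexp ((t * (W f - a) : ℝ) * I)) := by
    rw [show ((t * (W f - a) : ℝ) : ℂ) * I = -(t * a : ℝ) * I + (t * W f : ℝ) * I by
      push_cast; ring, Complex.exp_add]
    ring
  rw [h2, re_ofReal_mul, exp_mul_I, ← ofReal_cos, ← ofReal_sin]
  simp only [mul_re, add_re, sub_re, mul_im, add_im, sub_im, ofReal_re, ofReal_im, I_re, I_im]
  ring

open Complex in
theorem sum_ite_lt_le_gaussQ_add {κ : Type*} [Fintype κ] (p W : κ → ℝ) (hp : ∀ f, 0 ≤ p f)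
    (hp1 : ∑ f, p f = 1) (a : ℝ) {T : ℝ} (hT : 0 < T) (h : ℝ → ℝ) (hc : Continuous h)
    (hΔ : ∀ t, 0 < t → t < T →
      ‖∑ f, p f * cexp ((t * W f : ℝ) * I) - Real.exp (-t ^ 2 / 2)‖ ≤ t * h t) :
    ∑ f, p f * (if a < W f then 1 else 0) ≤
      gaussQ a + 1 / T * (√(2 * π) / 2 * (1 + 0.55 / T ^ 2) - 1 / T) +
        1.033 / π * ∫ t in (0 : ℝ)..T, h t := by
  have h1 : ∑ f, p f * (if a < W f then 1 else 0) ≤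
      ∑ f, p f * beurlingMajorant (T * (W f - a) / (2 * π)) := by
    refine Finset.sum_le_sum fun f _ => mul_le_mul_of_nonneg_left ?_ (hp f)
    split_ifs with hf
    · exact one_le_beurlingMajorant (by have := sub_pos.2 hf; positivity)
    · rcases (not_lt.1 hf).eq_or_lt with hf | hf
      · rw [hf]; simpa using zero_le_one.trans (one_le_beurlingMajorant le_rfl)
      · exact beurlingMajorant_nonneg_of_neg
          (div_neg_of_neg_of_pos (mul_neg_of_pos_of_neg hT (by linarith)) (by positivity))
  have h2 : ∑ f, p f * beurlingMajorant (T * (W f - a) / (2 * π)) =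
      1 / 2 + ∫ s in (0 : ℝ)..1, ∑ f, p f * ((1 - s) * Real.cos (T * s * (W f - a)) +
        beurlingWeight s * Real.sin (T * s * (W f - a))) := by
    have e : ∀ f s, 2 * π * (T * (W f - a) / (2 * π)) * s = T * s * (W f - a) := fun f s => by
      field_simp
    have hi := fun f => intervalIntegrable_beurlingMajorant (2 * π * (T * (W f - a) / (2 * π)))
    simp only [e] at hi
    rw [intervalIntegral.integral_finsetSum fun f _ => (hi f).const_mul _]
    simp only [beurlingMajorant, e, mul_add (p _) (1 / 2) _, Finset.sum_add_distrib,
      ← Finset.sum_mul, hp1, one_mul, intervalIntegral.integral_const_mul]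
  refine h1.trans (h2.le.trans ?_)
  have hg := gaussian_smoothing_le a hT
  have hγ1 : ∀ s, |Real.exp (-(T * s) ^ 2 / 2)| ≤ 1 := fun s => by
    rw [Real.abs_exp, Real.exp_le_one_iff]
    have := sq_nonneg (T * s)
    linarith
  have hfi : IntervalIntegrable (fun s => (1 - s) * (Real.exp (-(T * s) ^ 2 / 2) *
      Real.cos (T * s * a)) - beurlingWeight s * (Real.exp (-(T * s) ^ 2 / 2) *
      Real.sin (T * s * a))) volume 0 1 :=
    (Continuous.intervalIntegrable (by fun_prop) _ _).sub
      (intervalIntegrable_beurlingWeight_mul (by fun_prop) |T * a| fun s h0 _ => by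
        rw [abs_mul, show T * s * a = T * a * s by ring]
        calc _ ≤ 1 * (|T * a| * s) :=
              mul_le_mul (hγ1 s) (abs_sin_mul_le _ h0) (abs_nonneg _) zero_le_one
          _ = _ := one_mul _)
  have hi2 : IntervalIntegrable (fun s => 1.033 / π * (T * h (T * s))) volume 0 1 :=
    Continuous.intervalIntegrable (by fun_prop) _ _
  have h3 : ∫ s in (0 : ℝ)..1, ∑ f, p f * ((1 - s) * Real.cos (T * s * (W f - a)) +
        beurlingWeight s * Real.sin (T * s * (W f - a))) ≤
      ∫ s in (0 : ℝ)..1, (((1 - s) * (Real.exp (-(T * s) ^ 2 / 2) *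
      Real.cos (T * s * a)) - beurlingWeight s * (Real.exp (-(T * s) ^ 2 / 2) *
      Real.sin (T * s * a))) + 1.033 / π * (T * h (T * s))) := by
    refine intervalIntegral.integral_mono_on_of_le_Ioo zero_le_one ?_ (hfi.add hi2) ?_
    · have hi := fun f => intervalIntegrable_beurlingMajorant (T * (W f - a))
      have e : ∀ f s, T * (W f - a) * s = T * s * (W f - a) := fun f s => by ring
      simp only [e] at hi
      simpa only [Finset.sum_fn] using
        IntervalIntegrable.sum Finset.univ fun f _ => (hi f).const_mul (p f)
    · intro s hs
      rw [re_im_smoothing]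
      refine add_le_add_right ((re_le_norm _).trans ?_) _
      rw [norm_mul, norm_mul, ← ofReal_neg, norm_exp_ofReal_mul_I, mul_one]
      have hb : ‖(((1 - s : ℝ) : ℂ) - beurlingWeight s * I)‖ ≤ 1.033 / (π * s) := by
        have hpos : 0 ≤ 1.033 / (π * s) := by have := hs.1; positivity
        refine abs_le_of_sq_le_sq' ?_ hpos |>.2
        refine le_trans (le_of_eq ?_) (sq_add_beurlingWeight_sq_le hs.1 hs.2)
        rw [← normSq_eq_norm_sq, normSq_apply]
        simp
        ring
      have hd := hΔ (T * s) (mul_pos hT hs.1) (by nlinarith [hs.2])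
      calc _ ≤ 1.033 / (π * s) * (T * s * h (T * s)) :=
            mul_le_mul hb hd (norm_nonneg _) ((norm_nonneg _).trans hb)
        _ = _ := by
            have := hs.1.ne'
            field_simp
  rw [intervalIntegral.integral_add hfi hi2, intervalIntegral.integral_const_mul,
    intervalIntegral.integral_const_mul, intervalIntegral.mul_integral_comp_mul_left,
    mul_zero, mul_one] at h3
  linarith

open Complex in
theorem norm_cexp_mul_I_sub_quadratic_le_of_nonneg {x : ℝ} (hx : 0 ≤ x) :
    ‖cexp (x * I) - (1 + x * I - x ^ 2 / 2)‖ ≤ x ^ 3 / 6 := by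
  have hx1 : ∀ y : ℝ, HasDerivAt (fun y : ℝ => (y : ℂ) * I) I y := fun y => by
    simpa using (Complex.ofRealCLM.hasDerivAt (x := y)).mul_const I
  have hx2 : ∀ y : ℝ, HasDerivAt (fun y : ℝ => (y : ℂ) ^ 2 / 2) (y : ℂ) y := fun y => by
    refine (((Complex.ofRealCLM.hasDerivAt (x := y)).pow 2).div_const 2).congr_deriv ?_
    simp
  have h1 : ∀ y : ℝ, ‖cexp (y * I) - 1‖ ≤ |y| := fun y => by
    simpa [mul_comm] using Real.norm_exp_I_mul_ofReal_sub_one_le (x := y)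
  have h2 : ∀ y : ℝ, 0 ≤ y → ‖cexp (y * I) - (1 + y * I)‖ ≤ y ^ 2 / 2 := fun y hy => by
    have hd : ∀ z : ℝ, HasDerivAt (fun z : ℝ => cexp (z * I) - (1 + z * I))
        (cexp (z * I) * I - I) z := fun z =>
      (hx1 z).cexp.sub ((hx1 z).const_add 1)
    refine image_norm_le_of_norm_deriv_right_le_deriv_boundary (a := 0) (b := y)
      (B := fun y => y ^ 2 / 2) (B' := fun y => y)
      (fun z _ => (hd z).continuousAt.continuousWithinAt)
      (fun z _ => (hd z).hasDerivWithinAt) (by simp) (fun z => ?_) (fun z hz => ?_) ⟨hy, le_rfl⟩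
    · refine (((hasDerivAt_id z).pow 2).div_const 2).congr_deriv ?_
      simp
    · rw [show cexp (z * I) * I - I = (cexp (z * I) - 1) * I by ring, norm_mul, norm_I, mul_one]
      simpa [abs_of_nonneg hz.1] using h1 z
  have hd : ∀ z : ℝ, HasDerivAt (fun z : ℝ => cexp (z * I) - (1 + z * I - z ^ 2 / 2))
      (cexp (z * I) * I - (I - z)) z := fun z =>
    (hx1 z).cexp.sub (((hx1 z).const_add 1).sub (hx2 z))
  refine image_norm_le_of_norm_deriv_right_le_deriv_boundary (a := 0) (b := x)
    (B := fun y => y ^ 3 / 6) (B' := fun y => y ^ 2 / 2)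
    (fun z _ => (hd z).continuousAt.continuousWithinAt)
    (fun z _ => (hd z).hasDerivWithinAt) (by simp) (fun z => ?_) (fun z hz => ?_) ⟨hx, le_rfl⟩
  · refine (((hasDerivAt_id z).pow 3).div_const 6).congr_deriv ?_
    simp
    ring
  · rw [show cexp (z * I) * I - (I - z) = (cexp (z * I) - (1 + z * I)) * I by
      linear_combination (z : ℂ) * I_sq, norm_mul, norm_I, mul_one]
    exact h2 z hz.1

open Complex in
theorem norm_cexp_mul_I_sub_quadratic_le (x : ℝ) :
    ‖cexp (x * I) - (1 + x * I - x ^ 2 / 2)‖ ≤ |x| ^ 3 / 6 := by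
  rcases le_total 0 x with hx | hx
  · rw [abs_of_nonneg hx]
    exact norm_cexp_mul_I_sub_quadratic_le_of_nonneg hx
  · rw [abs_of_nonpos hx, ← norm_conj]
    have h := norm_cexp_mul_I_sub_quadratic_le_of_nonneg (neg_nonneg.2 hx)
    simpa [← exp_conj, map_ofNat] using h

theorem exp_neg_le_quadratic {y : ℝ} (hy : 0 ≤ y) : rexp (-y) ≤ 1 - y + y ^ 2 / 2 := by
  have h := quadratic_le_exp_of_nonneg hy
  rw [exp_neg, inv_le_iff_one_le_mul₀ (exp_pos y)]
  nlinarith [sq_nonneg (y ^ 2), sq_nonneg (y - 1)]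

theorem norm_pow_sub_pow_le {a b : ℂ} {A B : ℝ} (ha : ‖a‖ ≤ A) (hb : ‖b‖ ≤ B) (m : ℕ) :
    ‖a ^ (m + 1) - b ^ (m + 1)‖ ≤ ‖a - b‖ * ((m + 1 : ℕ) * ((A ^ m + B ^ m) / 2)) := by
  have hA : 0 ≤ A := (norm_nonneg a).trans ha
  have hB : 0 ≤ B := (norm_nonneg b).trans hb
  rw [← (Commute.all a b).mul_geom_sum₂, norm_mul]
  refine mul_le_mul_of_nonneg_left ?_ (norm_nonneg _)
  have h1 : ‖∑ i ∈ Finset.range (m + 1), a ^ i * b ^ (m + 1 - 1 - i)‖ ≤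
      ∑ i ∈ Finset.range (m + 1), A ^ i * B ^ (m - i) := by
    refine norm_sum_le_of_le _ fun i _ => ?_
    rw [norm_mul, norm_pow, norm_pow, Nat.add_sub_cancel]
    gcongr
  have h2 : ∑ i ∈ Finset.range (m + 1), A ^ i * B ^ (m - i) =
      ∑ i ∈ Finset.range (m + 1), A ^ (m - i) * B ^ i := by
    rw [← Finset.sum_range_reflect]
    refine Finset.sum_congr rfl fun i hi => ?_
    have := Finset.mem_range.1 hi
    congr 2
    omega
  have h3 : ∀ i ∈ Finset.range (m + 1),
      A ^ i * B ^ (m - i) + A ^ (m - i) * B ^ i ≤ A ^ m + B ^ m := by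
    intro i hi
    have := Finset.mem_range.1 hi
    have e1 : A ^ m = A ^ i * A ^ (m - i) := by rw [← pow_add]; congr 1; omega
    have e2 : B ^ m = B ^ i * B ^ (m - i) := by rw [← pow_add]; congr 1; omega
    rw [e1, e2]
    rcases le_total A B with h | h
    · nlinarith [mul_nonneg (sub_nonneg.2 (pow_le_pow_left₀ hA h i))
        (sub_nonneg.2 (pow_le_pow_left₀ hA h (m - i)))]
    · nlinarith [mul_nonneg (sub_nonneg.2 (pow_le_pow_left₀ hB h i))
        (sub_nonneg.2 (pow_le_pow_left₀ hB h (m - i)))]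
  have h4 := Finset.sum_le_sum h3
  rw [Finset.sum_add_distrib, ← h2] at h4
  simp only [Finset.sum_const, Finset.card_range, nsmul_eq_mul] at h4
  linarith

theorem one_le_sum_mul_abs_cube {ι : Type*} [Fintype ι] {q z : ι → ℝ} (hq : ∀ i, 0 ≤ q i)
    (hq1 : ∑ i, q i = 1) (hz2 : ∑ i, q i * z i ^ 2 = 1) : 1 ≤ ∑ i, q i * |z i| ^ 3 := by
  have h : ∑ i, q i * ((3 * z i ^ 2 - 1) / 2) ≤ ∑ i, q i * |z i| ^ 3 := by
    refine Finset.sum_le_sum fun i _ => mul_le_mul_of_nonneg_left ?_ (hq i)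
    rw [← sq_abs]
    nlinarith [mul_nonneg (sq_nonneg (|z i| - 1)) (by positivity : 0 ≤ 2 * |z i| + 1)]
  have e : ∑ i, q i * ((3 * z i ^ 2 - 1) / 2) = (3 * ∑ i, q i * z i ^ 2 - ∑ i, q i) / 2 := by
    rw [Finset.mul_sum, ← Finset.sum_sub_distrib, Finset.sum_div]
    exact Finset.sum_congr rfl fun i _ => by ring
  rw [e, hq1, hz2] at h
  linarith

open Complex in
theorem norm_sum_mul_cexp_sub_le {ι : Type*} [Fintype ι] {q z : ι → ℝ} (hq : ∀ i, 0 ≤ q i)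
    (hq1 : ∑ i, q i = 1) (hz1 : ∑ i, q i * z i = 0) (hz2 : ∑ i, q i * z i ^ 2 = 1)
    {u : ℝ} (hu : 0 ≤ u) :
    ‖∑ i, q i * cexp ((u * z i : ℝ) * I) - (1 - u ^ 2 / 2 : ℝ)‖ ≤
      (∑ i, q i * |z i| ^ 3) * u ^ 3 / 6 := by
  have e : ((1 - u ^ 2 / 2 : ℝ) : ℂ) =
      ∑ i, (q i : ℂ) * (1 + (u * z i : ℝ) * I - ((u * z i : ℝ) : ℂ) ^ 2 / 2) := by
    have e1 : ∀ i, (q i : ℂ) * (1 + (u * z i : ℝ) * I - ((u * z i : ℝ) : ℂ) ^ 2 / 2) =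
        (q i : ℝ) + ((q i * z i : ℝ) : ℂ) * (u * I) - ((q i * z i ^ 2 : ℝ) : ℂ) * (u ^ 2 / 2) :=
      fun i => by push_cast; ring
    simp only [e1, Finset.sum_sub_distrib, Finset.sum_add_distrib, ← Finset.sum_mul,
      ← ofReal_sum, hq1, hz1, hz2]
    push_cast
    ring
  rw [e, ← Finset.sum_sub_distrib, Finset.sum_mul, Finset.sum_div]
  refine norm_sum_le_of_le _ fun i _ => ?_
  rw [← mul_sub, norm_mul, norm_real, norm_of_nonneg (hq i)]
  refine (mul_le_mul_of_nonneg_left (norm_cexp_mul_I_sub_quadratic_le _) (hq i)).trans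
    (le_of_eq ?_)
  rw [abs_mul, abs_of_nonneg hu]
  ring

open Complex in
theorem norm_sum_prod_mul_cexp_sub_le {ι : Type*} [Fintype ι] {q z : ι → ℝ} (hq : ∀ i, 0 ≤ q i)
    (hq1 : ∑ i, q i = 1) (hz1 : ∑ i, q i * z i = 0) (hz2 : ∑ i, q i * z i ^ 2 = 1)
    (m : ℕ) {ℓ t : ℝ} (hℓ : ℓ = (∑ i, q i * |z i| ^ 3) / √(m + 1 : ℕ)) (ht : 0 ≤ t)
    (htℓ : ℓ * t ≤ √2) :
    ‖∑ f : Fin (m + 1) → ι, (∏ j, q (f j) : ℝ) *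
        cexp ((t * ((∑ j, z (f j)) / √(m + 1 : ℕ)) : ℝ) * I) - Real.exp (-t ^ 2 / 2)‖ ≤
      t * (ℓ * (t ^ 2 / 6 + ℓ * t ^ 3 / 8) *
        ((rexp (-(m / (m + 1) * (t ^ 2 / 2) * (1 - ℓ * t / 3))) +
          rexp (-(m / (m + 1) * (t ^ 2 / 2)))) / 2)) := by
  set r := ∑ i, q i * |z i| ^ 3 with hr
  have hr1 : 1 ≤ r := one_le_sum_mul_abs_cube hq hq1 hz2
  set N : ℝ := √(m + 1 : ℕ) with hN
  have hNsq : N ^ 2 = m + 1 := by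
    rw [hN, sq_sqrt (Nat.cast_nonneg _)]; push_cast; ring
  have hN0 : 0 < N := by rw [hN]; positivity
  set u := t / N with hu
  have hu0 : 0 ≤ u := by positivity
  have htu : t = u * N := by rw [hu]; field_simp
  have hℓr : ℓ * N = r := by rw [hℓ]; field_simp
  have hu2 : u ^ 2 ≤ 2 := by
    have h1 : u ≤ √2 := by
      refine le_trans ?_ htℓ
      rw [htu, show ℓ * (u * N) = (ℓ * N) * u by ring, hℓr]
      nlinarith
    calc u ^ 2 ≤ √2 ^ 2 := by gcongr
      _ = 2 := sq_sqrt (by norm_num)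
  set F : ℂ := ∑ i, q i * cexp ((u * z i : ℝ) * I) with hF
  have hpow : ∑ f : Fin (m + 1) → ι, (∏ j, q (f j) : ℝ) *
        cexp ((t * ((∑ j, z (f j)) / N) : ℝ) * I) = F ^ (m + 1) := by
    rw [hF, Fintype.sum_pow]
    refine Finset.sum_congr rfl fun f _ => ?_
    rw [Finset.prod_mul_distrib, ← Complex.exp_sum, ofReal_prod, ← Finset.sum_mul,
      ← ofReal_sum, ← Finset.mul_sum]
    congr 4
    rw [hu]
    ring
  set G : ℝ := rexp (-(u ^ 2 / 2)) with hG
  have hGpow : ((rexp (-t ^ 2 / 2) : ℝ) : ℂ) = (G : ℂ) ^ (m + 1) := by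
    rw [← ofReal_pow, hG, ← Real.exp_nat_mul]
    congr 2
    rw [htu, mul_pow, hNsq]
    push_cast
    ring
  have hFq : ‖F - (1 - u ^ 2 / 2 : ℝ)‖ ≤ r * u ^ 3 / 6 :=
    norm_sum_mul_cexp_sub_le hq hq1 hz1 hz2 hu0
  set A : ℝ := rexp (-(u ^ 2 / 2) + r * u ^ 3 / 6) with hA
  have hFA : ‖F‖ ≤ A := by
    have h1 : ‖((1 - u ^ 2 / 2 : ℝ) : ℂ)‖ = 1 - u ^ 2 / 2 := by
      rw [norm_real, norm_of_nonneg]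
      linarith
    have h2 := norm_sub_norm_le F ((1 - u ^ 2 / 2 : ℝ) : ℂ)
    have h3 := Real.add_one_le_exp (-(u ^ 2 / 2) + r * u ^ 3 / 6)
    linarith
  have hFG : ‖F - G‖ ≤ r * u ^ 3 / 6 + u ^ 4 / 8 := by
    have h1 : ‖((1 - u ^ 2 / 2 : ℝ) : ℂ) - G‖ ≤ u ^ 4 / 8 := by
      rw [← ofReal_sub, norm_real, Real.norm_eq_abs, abs_le]
      have h2 := exp_neg_le_quadratic (y := u ^ 2 / 2) (by positivity)
      have h3 := Real.add_one_le_exp (-(u ^ 2 / 2))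
      have h4 : 0 ≤ u ^ 4 := by positivity
      constructor <;> nlinarith
    linarith [norm_sub_le_norm_sub_add_norm_sub F ((1 - u ^ 2 / 2 : ℝ) : ℂ) G]
  have hGn : ‖(G : ℂ)‖ ≤ G := by rw [norm_real, norm_of_nonneg (Real.exp_pos _).le]
  have hmain := norm_pow_sub_pow_le hFA hGn m
  have hm : (m : ℝ) / (m + 1) * (t ^ 2 / 2) = m * (u ^ 2 / 2) := by
    rw [htu, mul_pow, hNsq]
    field_simp
  have hAm : A ^ m = rexp (-(m / (m + 1) * (t ^ 2 / 2) * (1 - ℓ * t / 3))) := by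
    rw [hA, ← Real.exp_nat_mul, hm, htu, ← hℓr]
    congr 1
    ring
  have hGm : G ^ m = rexp (-(m / (m + 1) * (t ^ 2 / 2))) := by
    rw [hG, ← Real.exp_nat_mul, hm]
    congr 1
    ring
  rw [hpow, hGpow, ← hAm, ← hGm]
  refine hmain.trans ?_
  have hS : 0 ≤ (A ^ m + G ^ m) / 2 := by positivity
  have hk : (r * u ^ 3 / 6 + u ^ 4 / 8) * (m + 1 : ℕ) ≤ t * (ℓ * (t ^ 2 / 6 + ℓ * t ^ 3 / 8)) := by
    have e : t * (ℓ * (t ^ 2 / 6 + ℓ * t ^ 3 / 8)) =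
        (r * u ^ 3 / 6 + r ^ 2 * (u ^ 4 / 8)) * N ^ 2 := by
      rw [htu, ← hℓr]
      ring
    rw [e, hNsq]
    push_cast
    gcongr
    exact le_mul_of_one_le_left (by positivity) (one_le_pow₀ hr1)
  calc _ ≤ (r * u ^ 3 / 6 + u ^ 4 / 8) * ((m + 1 : ℕ) * ((A ^ m + G ^ m) / 2)) := by gcongr
    _ = ((r * u ^ 3 / 6 + u ^ 4 / 8) * (m + 1 : ℕ)) * ((A ^ m + G ^ m) / 2) := by ring
    _ ≤ t * (ℓ * (t ^ 2 / 6 + ℓ * t ^ 3 / 8)) * ((A ^ m + G ^ m) / 2) := by gcongr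
    _ = _ := by ring

/-- The integrand which dominates the difference of characteristic functions in the smoothing
inequality. -/
noncomputable def charFunMajorant (b ℓ t : ℝ) : ℝ :=
  (t ^ 2 / 6 + ℓ * t ^ 3 / 8) *
    ((rexp (-(b * (t ^ 2 / 2) * (1 - ℓ * t / 3))) + rexp (-(b * (t ^ 2 / 2)))) / 2)

theorem continuous_charFunMajorant (b ℓ : ℝ) : Continuous (charFunMajorant b ℓ) := by
  unfold charFunMajorant
  fun_prop

theorem sqrt_two_mem : 1.4142 < √2 ∧ √2 < 1.41422 :=
  ⟨lt_sqrt_of_sq_lt (by norm_num), (sqrt_lt' (by norm_num)).2 (by norm_num)⟩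

theorem sqrt_pi_lt : √π < 1.77248 :=
  (sqrt_lt' (by norm_num)).2 (by have := pi_lt_d4; norm_num; linarith)

theorem charFunMajorant_anti {b b' ℓ t : ℝ} (hb : b' ≤ b) (hℓ : 0 ≤ ℓ) (ht : 0 ≤ t)
    (hy : ℓ * t ≤ 3) : charFunMajorant b ℓ t ≤ charFunMajorant b' ℓ t := by
  have h : 0 ≤ 1 - ℓ * t / 3 := by linarith
  unfold charFunMajorant
  gcongr

theorem mul_exp_neg_le (x : ℝ) : x * rexp (-x) ≤ rexp (-1) := by
  have h := add_one_le_exp (x - 1)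
  rw [sub_add_cancel] at h
  calc x * rexp (-x) ≤ rexp (x - 1) * rexp (-x) := by gcongr
    _ = rexp (-1) := by rw [← exp_add]; congr 1; ring

theorem exp_neg_one_lt : rexp (-1) < 0.36788 := exp_neg_one_lt_d9.trans (by norm_num)

theorem sq_mul_exp_neg_le {b t w : ℝ} (hb : 0 < b) (hw : 0 < w) :
    t ^ 2 * rexp (-(b * (t ^ 2 / 2) * w)) ≤ 0.73576 / b * (1 / w) := by
  have h := (mul_exp_neg_le (b * (t ^ 2 / 2) * w)).trans exp_neg_one_lt.le
  rw [div_mul_div_comm, mul_one, le_div_iff₀ (by positivity)]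
  linarith

theorem one_div_one_sub_div_three_le {y : ℝ} (h1 : y ≤ 1.41422) :
    1 / (1 - y / 3) ≤ 1 + y / 3 + 0.2103 * y ^ 2 := by
  rw [div_le_iff₀ (by linarith)]
  nlinarith [mul_nonneg (sq_nonneg y) (sub_nonneg.2 h1)]

theorem charFunMajorant_le_polynomial {b ℓ t : ℝ} (hb : 0 < b) (hℓ : 0 ≤ ℓ) (ht : 0 ≤ t)
    (hy : ℓ * t ≤ 1.41422) :
    charFunMajorant b ℓ t ≤ 0.36788 / b * ((1 / 6 + ℓ * t / 8) *
      (1 + ℓ * t / 3 + 0.2103 * (ℓ * t) ^ 2)) +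
      (t ^ 2 / 6 + ℓ * t ^ 3 / 8) * rexp (-(b / 2) * t ^ 2) / 2 := by
  have hy0 : 0 ≤ ℓ * t := mul_nonneg hℓ ht
  have h1 : t ^ 2 * rexp (-(b * (t ^ 2 / 2) * (1 - ℓ * t / 3))) ≤
      0.73576 / b * (1 + ℓ * t / 3 + 0.2103 * (ℓ * t) ^ 2) :=
    (sq_mul_exp_neg_le hb (by linarith)).trans
      (mul_le_mul_of_nonneg_left (one_div_one_sub_div_three_le hy) (by positivity))
  have h2 := mul_le_mul_of_nonneg_left h1 (by positivity : 0 ≤ (1 / 6 + ℓ * t / 8) / 2)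
  unfold charFunMajorant
  rw [show -(b / 2) * t ^ 2 = -(b * (t ^ 2 / 2)) by ring]
  calc _ = (1 / 6 + ℓ * t / 8) / 2 * (t ^ 2 * rexp (-(b * (t ^ 2 / 2) * (1 - ℓ * t / 3)))) +
        (t ^ 2 / 6 + ℓ * t ^ 3 / 8) * rexp (-(b * (t ^ 2 / 2))) / 2 := by ring
    _ ≤ _ := add_le_add_left (h2.trans (le_of_eq (by ring))) _

theorem integral_polynomial_comp_mul_le {ℓ : ℝ} (hℓ : 0 < ℓ) :
    ∫ t in (0 : ℝ)..√2 / ℓ, ((1 / 6 + ℓ * t / 8) * (1 + ℓ * t / 3 + 0.2103 * (ℓ * t) ^ 2)) ≤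
      0.51489 / ℓ := by
  rw [intervalIntegral.integral_comp_mul_left
    (fun y => (1 / 6 + y / 8) * (1 + y / 3 + 0.2103 * y ^ 2)) hℓ.ne', mul_zero,
    mul_div_cancel₀ _ hℓ.ne']
  have h : ∀ y ∈ uIcc (0 : ℝ) √2, HasDerivAt (fun y => y / 6 + (1 / 18 + 1 / 8) / 2 * y ^ 2 +
      (0.2103 / 6 + 1 / 24) / 3 * y ^ 3 + 0.2103 / 32 * y ^ 4)
      ((1 / 6 + y / 8) * (1 + y / 3 + 0.2103 * y ^ 2)) y := by
    intro y _
    have h1 := hasDerivAt_id y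
    refine ((((h1.div_const 6).add ((h1.pow 2).const_mul ((1 / 18 + 1 / 8) / 2))).add
      ((h1.pow 3).const_mul ((0.2103 / 6 + 1 / 24) / 3))).add
      ((h1.pow 4).const_mul (0.2103 / 32))).congr_deriv ?_
    simp
    ring
  rw [intervalIntegral.integral_eq_sub_of_hasDerivAt h
    (Continuous.intervalIntegrable (by fun_prop) _ _)]
  have h2 : √2 ^ 2 = 2 := sq_sqrt (by norm_num)
  have h3 : √2 ^ 3 = 2 * √2 := by rw [pow_succ, h2]
  have h4 : √2 ^ 4 = 4 := by rw [show √2 ^ 4 = (√2 ^ 2) ^ 2 by ring, h2]; norm_num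
  rw [h2, h3, h4, smul_eq_mul, inv_mul_eq_div]
  gcongr
  have := sqrt_two_mem.2
  norm_num
  linarith

theorem integral_linear_comp_mul_le {ℓ : ℝ} (hℓ : 0 < ℓ) :
    ∫ t in (0 : ℝ)..√2 / ℓ, (1 / 6 + ℓ * t / 8) ≤ 0.36071 / ℓ := by
  rw [intervalIntegral.integral_comp_mul_left (fun y => 1 / 6 + y / 8) hℓ.ne', mul_zero,
    mul_div_cancel₀ _ hℓ.ne', smul_eq_mul, inv_mul_eq_div]
  gcongr
  rw [intervalIntegral.integral_add (by simp) (Continuous.intervalIntegrable (by fun_prop) _ _),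
    intervalIntegral.integral_const, intervalIntegral.integral_div, integral_id, smul_eq_mul,
    sq_sqrt (by norm_num)]
  have := sqrt_two_mem.2
  norm_num
  linarith

theorem integral_charFunMajorant_le_of_integral_le {b b' ℓ K : ℝ} (hb : b' ≤ b) (hb' : 0 < b')
    (hℓ : 0 < ℓ)
    (hK : ∫ t in (0 : ℝ)..√2 / ℓ, (t ^ 2 / 6 + ℓ * t ^ 3 / 8) * rexp (-(b' / 2) * t ^ 2) ≤ K) :
    ∫ t in (0 : ℝ)..√2 / ℓ, charFunMajorant b ℓ t ≤ 0.18942 / (b' * ℓ) + K / 2 := by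
  have hpos : 0 ≤ √2 / ℓ := by positivity
  have h1 : ∫ t in (0 : ℝ)..√2 / ℓ, charFunMajorant b ℓ t ≤
      ∫ t in (0 : ℝ)..√2 / ℓ, (0.36788 / b' * ((1 / 6 + ℓ * t / 8) *
      (1 + ℓ * t / 3 + 0.2103 * (ℓ * t) ^ 2)) +
      (t ^ 2 / 6 + ℓ * t ^ 3 / 8) * rexp (-(b' / 2) * t ^ 2) / 2) := by
    refine intervalIntegral.integral_mono_on hpos
      ((continuous_charFunMajorant b ℓ).intervalIntegrable _ _)
      (Continuous.intervalIntegrable (by fun_prop) _ _) fun t ht => ?_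
    have hy : ℓ * t ≤ 1.41422 := by
      have := (le_div_iff₀ hℓ).1 ht.2
      linarith [sqrt_two_mem.2]
    exact (charFunMajorant_anti hb hℓ.le ht.1 (by linarith)).trans
      (charFunMajorant_le_polynomial hb' hℓ.le ht.1 hy)
  rw [intervalIntegral.integral_add (Continuous.intervalIntegrable (by fun_prop) _ _)
    (Continuous.intervalIntegrable (by fun_prop) _ _), intervalIntegral.integral_const_mul,
    intervalIntegral.integral_div] at h1
  have h2 := mul_le_mul_of_nonneg_left (integral_polynomial_comp_mul_le hℓ)
    (by positivity : 0 ≤ 0.36788 / b')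
  have h3 : 0.36788 / b' * (0.51489 / ℓ) ≤ 0.18942 / (b' * ℓ) := by
    rw [div_mul_div_comm]
    gcongr
    norm_num
  linarith

theorem integral_charFunMajorant_le_crude {b b' ℓ : ℝ} (hb : b' ≤ b) (hb' : 0 < b')
    (hℓ : 0 < ℓ) :
    ∫ t in (0 : ℝ)..√2 / ℓ, charFunMajorant b ℓ t ≤ 0.32213 / (b' * ℓ) := by
  have hpos : 0 ≤ √2 / ℓ := by positivity
  have hK : ∫ t in (0 : ℝ)..√2 / ℓ, (t ^ 2 / 6 + ℓ * t ^ 3 / 8) * rexp (-(b' / 2) * t ^ 2) ≤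
      0.26541 / (b' * ℓ) := by
    have h1 : ∫ t in (0 : ℝ)..√2 / ℓ, (t ^ 2 / 6 + ℓ * t ^ 3 / 8) * rexp (-(b' / 2) * t ^ 2) ≤
        ∫ t in (0 : ℝ)..√2 / ℓ, 0.73576 / b' * (1 / 6 + ℓ * t / 8) := by
      refine intervalIntegral.integral_mono_on hpos
        (Continuous.intervalIntegrable (by fun_prop) _ _)
        (Continuous.intervalIntegrable (by fun_prop) _ _) fun t ht => ?_
      have h := sq_mul_exp_neg_le (t := t) hb' one_pos
      have ht0 := ht.1
      have h2 := mul_le_mul_of_nonneg_left h (by positivity : 0 ≤ 1 / 6 + ℓ * t / 8)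
      calc _ = (1 / 6 + ℓ * t / 8) * (t ^ 2 * rexp (-(b' * (t ^ 2 / 2) * 1))) := by
            rw [show -(b' / 2) * t ^ 2 = -(b' * (t ^ 2 / 2) * 1) by ring]
            ring
        _ ≤ _ := h2.trans (le_of_eq (by ring))
    rw [intervalIntegral.integral_const_mul] at h1
    have h2 := mul_le_mul_of_nonneg_left (integral_linear_comp_mul_le hℓ)
      (by positivity : 0 ≤ 0.73576 / b')
    have h3 : 0.73576 / b' * (0.36071 / ℓ) ≤ 0.26541 / (b' * ℓ) := by
      rw [div_mul_div_comm]
      gcongr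
      norm_num
    linarith
  refine (integral_charFunMajorant_le_of_integral_le hb hb' hℓ hK).trans ?_
  rw [div_right_comm, ← add_div]
  gcongr
  norm_num

theorem intervalIntegral_le_integral_Ioi {f : ℝ → ℝ} (hf : IntegrableOn f (Ioi 0))
    (h0 : ∀ t, 0 < t → 0 ≤ f t) {T : ℝ} (hT : 0 ≤ T) :
    ∫ t in (0 : ℝ)..T, f t ≤ ∫ t in Ioi (0 : ℝ), f t := by
  rw [intervalIntegral.integral_of_le hT]
  exact setIntegral_mono_set hf ((ae_restrict_mem measurableSet_Ioi).mono fun t ht => h0 t ht)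
    (ae_of_all _ fun t ht => ht.1)

theorem integral_charFunMajorant_le_mid {b ℓ : ℝ} (hb : 0.7696 ≤ b) (hℓ : 0 < ℓ) :
    ∫ t in (0 : ℝ)..√2 / ℓ, charFunMajorant b ℓ t ≤
      0.18942 / (0.7696 * ℓ) + (0.30944 + 0.42213 * ℓ) / 2 := by
  refine integral_charFunMajorant_le_of_integral_le hb (by norm_num) hℓ ?_
  have hc : (0 : ℝ) < 0.7696 / 2 := by norm_num
  have i2 := (integrableOn_Ioi_pow_mul_exp_neg_mul_sq 2 hc).const_mul (1 / 6)
  have i3 := (integrableOn_Ioi_pow_mul_exp_neg_mul_sq 3 hc).const_mul (ℓ / 8)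
  have e : (fun t : ℝ => (t ^ 2 / 6 + ℓ * t ^ 3 / 8) * rexp (-(0.7696 / 2) * t ^ 2)) =
      fun t => 1 / 6 * (t ^ 2 * rexp (-(0.7696 / 2) * t ^ 2)) +
        ℓ / 8 * (t ^ 3 * rexp (-(0.7696 / 2) * t ^ 2)) := by
    ext t
    ring
  rw [e]
  refine (intervalIntegral_le_integral_Ioi (i2.add i3) (fun t ht => ?_) (by positivity)).trans ?_
  · have := ht.le
    have := exp_pos (-(0.7696 / 2) * t ^ 2)
    simp only [Pi.add_apply]
    positivity
  · refine (integral_add i2 i3).le.trans ?_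
    rw [integral_const_mul, integral_const_mul, integral_Ioi_sq_mul_exp_neg_mul_sq hc,
      integral_Ioi_cube_mul_exp_neg_mul_sq hc]
    have h1 : 0.6203 < √(0.7696 / 2) := lt_sqrt_of_sq_lt (by norm_num)
    have h2 : √π / (4 * (0.7696 / 2 * √(0.7696 / 2))) ≤ 1.8566 := by
      rw [div_le_iff₀ (by positivity)]
      linarith [sqrt_pi_lt]
    have h3 : 1 / (2 * (0.7696 / 2) ^ 2) ≤ (3.377 : ℝ) := by norm_num
    nlinarith

theorem charFunMajorant_le_convex {b ℓ t : ℝ} (hb : 0.82 ≤ b) (hℓ : 0 ≤ ℓ) (ht : 0 ≤ t)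
    (hy : ℓ * t ≤ √2) :
    charFunMajorant b ℓ t ≤ (t ^ 2 / 6 + ℓ * t ^ 3 / 8) * (rexp (-0.41 * t ^ 2) +
      0.35357 * (ℓ * t) * (rexp (-0.2166 * t ^ 2) - rexp (-0.41 * t ^ 2))) := by
  obtain ⟨hs, hs'⟩ := sqrt_two_mem
  refine (charFunMajorant_anti hb hℓ ht (by linarith)).trans ?_
  unfold charFunMajorant
  have hy0 : 0 ≤ ℓ * t := mul_nonneg hℓ ht
  refine mul_le_mul_of_nonneg_left ?_ (by positivity)
  set y := ℓ * t with hydef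
  have h2 : √2 * √2 = 2 := mul_self_sqrt (by norm_num)
  have hconv := convexOn_exp.2 (mem_univ (-0.41 * t ^ 2)) (mem_univ (-0.2166 * t ^ 2))
    (sub_nonneg.2 ((div_le_one (by positivity)).2 hy) : 0 ≤ 1 - y / √2)
    (by positivity : 0 ≤ y / √2) (by ring)
  simp only [smul_eq_mul] at hconv
  have hle : rexp (-(0.82 * (t ^ 2 / 2) * (1 - y / 3))) ≤
      rexp ((1 - y / √2) * (-0.41 * t ^ 2) + y / √2 * (-0.2166 * t ^ 2)) := by
    rw [exp_le_exp]
    have h3 : y / 3 * 0.41 ≤ y / √2 * (0.41 - 0.2166) := by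
      rw [div_mul_eq_mul_div, div_mul_eq_mul_div, div_le_div_iff₀ (by norm_num) (by positivity)]
      nlinarith
    nlinarith [mul_le_mul_of_nonneg_right h3 (sq_nonneg t)]
  have hmono : rexp (-0.41 * t ^ 2) ≤ rexp (-0.2166 * t ^ 2) :=
    exp_le_exp.2 (by nlinarith [sq_nonneg t])
  have h4 : y / √2 ≤ 2 * 0.35357 * y := by
    rw [div_le_iff₀ (by positivity)]
    nlinarith
  have h5 := mul_le_mul_of_nonneg_right h4 (sub_nonneg.2 hmono)
  rw [show -(0.82 * (t ^ 2 / 2)) = -0.41 * t ^ 2 by ring]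
  linarith

theorem integral_charFunMajorant_le_small {b ℓ : ℝ} (hb : 0.82 ≤ b) (hℓ : 0 < ℓ) :
    ∫ t in (0 : ℝ)..√2 / ℓ, charFunMajorant b ℓ t ≤ 0.2814 + 0.8247 * ℓ + 1.073 * ℓ ^ 2 := by
  have hpos : 0 ≤ √2 / ℓ := by positivity
  have hc : (0 : ℝ) < 0.41 := by norm_num
  have ha : (0 : ℝ) < 0.2166 := by norm_num
  have i2 := (integrableOn_Ioi_pow_mul_exp_neg_mul_sq 2 hc).const_mul (1 / 6)
  have i3 := (integrableOn_Ioi_pow_mul_exp_neg_mul_sq 3 hc).const_mul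
    (ℓ / 8 - 0.35357 * ℓ / 6)
  have i4 := (integrableOn_Ioi_pow_mul_exp_neg_mul_sq 4 hc).const_mul (-(0.35357 * ℓ ^ 2 / 8))
  have j3 := (integrableOn_Ioi_pow_mul_exp_neg_mul_sq 3 ha).const_mul (0.35357 * ℓ / 6)
  have j4 := (integrableOn_Ioi_pow_mul_exp_neg_mul_sq 4 ha).const_mul (0.35357 * ℓ ^ 2 / 8)
  set G : ℝ → ℝ := fun t => (t ^ 2 / 6 + ℓ * t ^ 3 / 8) * (rexp (-0.41 * t ^ 2) +
      0.35357 * (ℓ * t) * (rexp (-0.2166 * t ^ 2) - rexp (-0.41 * t ^ 2))) with hG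
  have e : G = (((fun t : ℝ => 1 / 6 * (t ^ 2 * rexp (-0.41 * t ^ 2))) +
      fun t : ℝ => (ℓ / 8 - 0.35357 * ℓ / 6) * (t ^ 3 * rexp (-0.41 * t ^ 2))) +
      fun t : ℝ => -(0.35357 * ℓ ^ 2 / 8) * (t ^ 4 * rexp (-0.41 * t ^ 2))) +
      ((fun t : ℝ => 0.35357 * ℓ / 6 * (t ^ 3 * rexp (-0.2166 * t ^ 2))) +
      fun t : ℝ => 0.35357 * ℓ ^ 2 / 8 * (t ^ 4 * rexp (-0.2166 * t ^ 2))) := by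
    ext t
    simp only [hG, Pi.add_apply]
    ring
  have hGi : IntegrableOn G (Ioi 0) := by
    rw [e]
    exact ((i2.add i3).add i4).add (j3.add j4)
  have h1 : ∫ t in (0 : ℝ)..√2 / ℓ, charFunMajorant b ℓ t ≤ ∫ t in (0 : ℝ)..√2 / ℓ, G t :=
    intervalIntegral.integral_mono_on hpos
      ((continuous_charFunMajorant b ℓ).intervalIntegrable _ _)
      (Continuous.intervalIntegrable (by fun_prop) _ _) fun t ht =>
        charFunMajorant_le_convex hb hℓ.le ht.1 (by
          have := (le_div_iff₀ hℓ).1 ht.2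
          linarith)
  refine h1.trans ((intervalIntegral_le_integral_Ioi hGi (fun t ht => ?_) hpos).trans ?_)
  · have hmono : rexp (-0.41 * t ^ 2) ≤ rexp (-0.2166 * t ^ 2) :=
      exp_le_exp.2 (by nlinarith [sq_nonneg t])
    have := sub_nonneg.2 hmono
    have := exp_pos (-0.41 * t ^ 2)
    simp only [hG]
    positivity
  rw [e, integral_add' ((i2.add i3).add i4) (j3.add j4), integral_add' (i2.add i3) i4,
    integral_add' i2 i3, integral_add' j3 j4]
  simp only [integral_const_mul]
  rw [integral_Ioi_sq_mul_exp_neg_mul_sq hc, integral_Ioi_cube_mul_exp_neg_mul_sq hc,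
    integral_Ioi_pow_four_mul_exp_neg_mul_sq hc, integral_Ioi_cube_mul_exp_neg_mul_sq ha,
    integral_Ioi_pow_four_mul_exp_neg_mul_sq ha]
  have hp := sqrt_pi_lt
  have hp' : 1.77245 < √π := lt_sqrt_of_sq_lt (by have := pi_gt_d6; norm_num; linarith)
  have hsc : 0.6403 < √0.41 := lt_sqrt_of_sq_lt (by norm_num)
  have hsc' : √0.41 < 0.64032 := (sqrt_lt' (by norm_num)).2 (by norm_num)
  have hsa : 0.4654 < √0.2166 := lt_sqrt_of_sq_lt (by norm_num)
  have m2 : √π / (4 * (0.41 * √0.41)) ≤ 1.688 := by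
    rw [div_le_iff₀ (by positivity)]
    linarith
  have m4 : 6.174 ≤ 3 * √π / (8 * (0.41 ^ 2 * √0.41)) := by
    rw [le_div_iff₀ (by positivity)]
    linarith
  have n4 : 3 * √π / (8 * (0.2166 ^ 2 * √0.2166)) ≤ 30.443 := by
    rw [div_le_iff₀ (by positivity)]
    linarith
  have m3 : 1 / (2 * 0.41 ^ 2) ≤ (2.97443 : ℝ) := by norm_num
  have m3' : (2.9744 : ℝ) ≤ 1 / (2 * 0.41 ^ 2) := by norm_num
  have n3 : 1 / (2 * 0.2166 ^ 2) ≤ (10.658 : ℝ) := by norm_num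
  have hl2 : 0 ≤ ℓ ^ 2 := sq_nonneg ℓ
  have t1 := mul_le_mul_of_nonneg_left m3 hℓ.le
  have t2 := mul_le_mul_of_nonneg_left n3 hℓ.le
  have t3 := mul_le_mul_of_nonneg_left m4 hl2
  have t4 := mul_le_mul_of_nonneg_left n4 hl2
  linarith

theorem integral_charFunMajorant_le {b ℓ : ℝ} (hℓ : 0 < ℓ) (hℓ1 : ℓ < 1) (hb : 1 / 2 ≤ b)
    (hb' : 1 - ℓ ^ 2 ≤ b) :
    ∫ t in (0 : ℝ)..√2 / ℓ, charFunMajorant b ℓ t ≤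
      3.0412 * (0.11376 + ℓ / 2 - 0.24372 * ℓ ^ 2) := by
  rcases le_total ℓ 0.42 with h1 | h1
  · refine (integral_charFunMajorant_le_small (by nlinarith) hℓ).trans ?_
    nlinarith
  rcases le_total ℓ 0.48 with h2 | h2
  · refine (integral_charFunMajorant_le_mid (by nlinarith) hℓ).trans ?_
    have h3 : 0.18942 / (0.7696 * ℓ) ≤ 0.58604 + (ℓ - 0.42) * (-1.2) := by
      rw [div_le_iff₀ (by positivity)]
      nlinarith
    nlinarith
  rcases le_total ℓ 0.7 with h3 | h3
  · refine (integral_charFunMajorant_le_crude hb' (by nlinarith) hℓ).trans ?_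
    have h4 : 0.32213 / ((1 - ℓ ^ 2) * ℓ) ≤ 0.9025 := by
      rw [div_le_iff₀ (mul_pos (by nlinarith) hℓ)]
      nlinarith [mul_nonneg (mul_nonneg (sub_nonneg.2 h2) (sub_nonneg.2 h3)) hℓ.le,
        mul_nonneg (sub_nonneg.2 h2) (sub_nonneg.2 h3)]
    nlinarith
  · refine (integral_charFunMajorant_le_crude hb (by norm_num) hℓ).trans ?_
    have h4 : 0.32213 / (1 / 2 * ℓ) ≤ 0.93 := by
      rw [div_le_iff₀ (by positivity)]
      linarith
    nlinarith

theorem gaussQ_sub_gaussQ (a b : ℝ) :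
    gaussQ a - gaussQ b = (√(2 * π))⁻¹ * ∫ u in a..b, rexp (-u ^ 2 / 2) := by
  have hi : ∀ c d, IntervalIntegrable (fun u : ℝ => rexp (-u ^ 2 / 2)) volume c d := fun c d =>
    Continuous.intervalIntegrable (by fun_prop) _ _
  rw [gaussQ_eq_sub_intervalIntegral, gaussQ_eq_sub_intervalIntegral,
    ← intervalIntegral.integral_add_adjacent_intervals (hi 0 a) (hi a b)]
  ring

theorem gaussQ_strictAnti : StrictAnti gaussQ := by
  intro a b hab
  rw [← sub_pos, gaussQ_sub_gaussQ]
  have := intervalIntegral.intervalIntegral_pos_of_pos_on (f := fun u : ℝ => rexp (-u ^ 2 / 2))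
    (Continuous.intervalIntegrable (by fun_prop) _ _) (fun x _ => exp_pos _) hab
  positivity

theorem gaussQ_nonneg (a : ℝ) : 0 ≤ gaussQ a :=
  mul_nonneg (by positivity) (setIntegral_nonneg measurableSet_Ioi fun _ _ => (exp_pos _).le)

theorem gaussQ_le_one (a : ℝ) : gaussQ a ≤ 1 := by
  have h := integral_gaussian (1 / 2)
  have e : (fun x : ℝ => rexp (-(1 / 2) * x ^ 2)) = fun x => rexp (-x ^ 2 / 2) := by
    ext x
    congr 1
    ring
  rw [e, show π / (1 / 2) = 2 * π by ring] at h
  unfold gaussQ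
  rw [inv_mul_le_one₀ (by positivity), ← h]
  exact setIntegral_le_integral integrable_exp_neg_sq_div_two (ae_of_all _ fun _ => (exp_pos _).le)

theorem gaussQ_lt_one (a : ℝ) : gaussQ a < 1 :=
  (gaussQ_strictAnti (sub_one_lt a)).trans_le (gaussQ_le_one _)

theorem sum_prod_eq_one {ι : Type*} [Fintype ι] {q : ι → ℝ} (hq1 : ∑ i, q i = 1) (n : ℕ) :
    ∑ f : Fin n → ι, ∏ j, q (f j) = 1 := by
  classical
  rw [← Fintype.piFinset_univ, ← Finset.prod_univ_sum]
  simp [hq1]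

/-- The Berry–Esseen inequality for finitely supported i.i.d. random variables,
with constant one. -/
theorem sum_prod_ite_lt_le_gaussQ_add {ι : Type*} [Fintype ι] {q z : ι → ℝ} (hq : ∀ i, 0 ≤ q i)
    (hq1 : ∑ i, q i = 1) (hz1 : ∑ i, q i * z i = 0) (hz2 : ∑ i, q i * z i ^ 2 = 1)
    {n : ℕ} (hn : 0 < n) (a : ℝ) :
    ∑ f : Fin n → ι, (∏ j, q (f j)) * (if a < (∑ j, z (f j)) / √n then 1 else 0) ≤
      gaussQ a + (∑ i, q i * |z i| ^ 3) / √n := by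
  have hsn : 0 < √(n : ℝ) := by positivity
  have hr := one_le_sum_mul_abs_cube hq hq1 hz2
  have hp : ∀ f : Fin n → ι, 0 ≤ ∏ j, q (f j) := fun f => Finset.prod_nonneg fun j _ => hq _
  set r := ∑ i, q i * |z i| ^ 3 with hrdef
  set ℓ := r / √n with hℓ
  have hℓ0 : 0 < ℓ := by positivity
  rcases le_or_gt 1 ℓ with h1 | h1
  · have : ∑ f : Fin n → ι, (∏ j, q (f j)) * (if a < (∑ j, z (f j)) / √n then 1 else 0) ≤ 1 := by
      refine (Finset.sum_le_sum fun f _ => mul_le_of_le_one_right (hp f) ?_).trans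
        (sum_prod_eq_one hq1 n).le
      split_ifs <;> norm_num
    linarith [gaussQ_nonneg a]
  obtain ⟨m, rfl⟩ : ∃ m, n = m + 1 := ⟨n - 1, by omega⟩
  have hnℓ : 1 / ((m + 1 : ℕ) : ℝ) ≤ ℓ ^ 2 := by
    rw [hℓ, div_pow, sq_sqrt (by positivity)]
    gcongr
    nlinarith
  have hm : 1 ≤ m := by
    by_contra h
    obtain rfl : m = 0 := by omega
    norm_num at hnℓ
    nlinarith
  have hm' : (1 : ℝ) ≤ m := by exact_mod_cast hm
  have hb : 1 / 2 ≤ (m : ℝ) / (m + 1) := by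
    rw [div_le_div_iff₀ (by norm_num) (by positivity)]
    linarith
  have hb' : 1 - ℓ ^ 2 ≤ (m : ℝ) / (m + 1) := by
    have : (m : ℝ) / (m + 1) = 1 - 1 / ((m + 1 : ℕ) : ℝ) := by
      push_cast
      field_simp
      ring
    linarith
  have hD := sum_ite_lt_le_gaussQ_add (fun f : Fin (m + 1) → ι => ∏ j, q (f j))
    (fun f => (∑ j, z (f j)) / √(m + 1 : ℕ)) hp (sum_prod_eq_one hq1 _) a
    (T := √2 / ℓ) (by positivity) (fun t => ℓ * charFunMajorant (m / (m + 1)) ℓ t)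
    ((continuous_charFunMajorant _ _).const_mul _) (fun t ht htT => by
      have hy : ℓ * t ≤ √2 := by
        have := (lt_div_iff₀ hℓ0).1 htT
        linarith
      refine (norm_sum_prod_mul_cexp_sub_le hq hq1 hz1 hz2 m hℓ ht.le hy).trans (le_of_eq ?_)
      unfold charFunMajorant
      ring)
  refine hD.trans ?_
  rw [intervalIntegral.integral_const_mul]
  have hJ := integral_charFunMajorant_le hℓ0 h1 hb hb'
  set J := ∫ t in (0 : ℝ)..√2 / ℓ, charFunMajorant (m / (m + 1)) ℓ t
  have h2 : √2 ^ 2 = 2 := sq_sqrt (by norm_num)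
  have e1 : 1 / (√2 / ℓ) * (√(2 * π) / 2 * (1 + 0.55 / (√2 / ℓ) ^ 2) - 1 / (√2 / ℓ)) =
      ℓ * (√π / 2 * (1 + 0.275 * ℓ ^ 2) - ℓ / 2) := by
    rw [sqrt_mul (by norm_num), div_pow, h2]
    field_simp
    rw [h2]
    ring
  have h3 : 1.033 / π * J ≤ 0.11376 + ℓ / 2 - 0.24372 * ℓ ^ 2 := by
    have h0 : 0 ≤ 0.11376 + ℓ / 2 - 0.24372 * ℓ ^ 2 := by nlinarith
    rw [div_mul_eq_mul_div, div_le_iff₀ pi_pos]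
    nlinarith [mul_le_mul_of_nonneg_left pi_gt_d6.le h0]
  have h4 : √π / 2 * (1 + 0.275 * ℓ ^ 2) ≤ 0.88624 * (1 + 0.275 * ℓ ^ 2) := by
    gcongr
    linarith [sqrt_pi_lt]
  have h5 : ℓ * (√π / 2 * (1 + 0.275 * ℓ ^ 2) - ℓ / 2) + ℓ * (1.033 / π * J) ≤ ℓ := by
    rw [← mul_add]
    exact mul_le_of_le_one_right hℓ0.le (by nlinarith)
  rw [e1]
  linarith

theorem mul_sub_le_gaussQ_sub {s t : ℝ} (hst : s ≤ t) (hts : t ≤ s + 1) :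
    (√(2 * π))⁻¹ * rexp (-(|s| + 1) ^ 2 / 2) * (t - s) ≤ gaussQ s - gaussQ t := by
  rw [gaussQ_sub_gaussQ, mul_assoc]
  refine mul_le_mul_of_nonneg_left ?_ (by positivity)
  have h : ∫ _ in s..t, rexp (-(|s| + 1) ^ 2 / 2) ≤ ∫ u in s..t, rexp (-u ^ 2 / 2) := by
    refine intervalIntegral.integral_mono_on hst (by simp)
      (Continuous.intervalIntegrable (by fun_prop) _ _) fun u hu => ?_
    have hu' : |u| ≤ |s| + 1 := by
      rw [abs_le]
      constructor <;> linarith [neg_abs_le s, le_abs_self s, hu.1, hu.2]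
    have := pow_le_pow_left₀ (abs_nonneg u) hu' 2
    rw [sq_abs] at this
    gcongr
  rw [intervalIntegral.integral_const, smul_eq_mul] at h
  linarith

theorem exists_forall_sub_mul_sqrt_le {s K : ℝ} (hK : 0 ≤ K) :
    ∃ C, ∀ n : ℕ, 0 < n → ∀ t, gaussQ t = gaussQ s - K / √n → (t - s) * √n ≤ C := by
  have hn (n : ℕ) : ∃ C, ∀ t, gaussQ t = gaussQ s - K / √n → (t - s) * √n ≤ C := by
    by_cases h : ∃ t, gaussQ t = gaussQ s - K / √n
    · obtain ⟨t, ht⟩ := h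
      exact ⟨(t - s) * √n, fun t' ht' => by
        rw [gaussQ_strictAnti.injective (ht'.trans ht.symm)]⟩
    · exact ⟨0, fun t ht => (h ⟨t, ht⟩).elim⟩
  choose c hc using hn
  have hδ : 0 < gaussQ s - gaussQ (s + 1) := sub_pos.2 (gaussQ_strictAnti (lt_add_one s))
  set δ := gaussQ s - gaussQ (s + 1)
  have hd : 0 < (√(2 * π))⁻¹ * rexp (-(|s| + 1) ^ 2 / 2) := by positivity
  set d := (√(2 * π))⁻¹ * rexp (-(|s| + 1) ^ 2 / 2) with hd'
  have hsum : 0 ≤ ∑ k ∈ Finset.range ⌈(K / δ) ^ 2⌉₊, |c k| :=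
    Finset.sum_nonneg fun _ _ => abs_nonneg _
  refine ⟨K / d + ∑ k ∈ Finset.range ⌈(K / δ) ^ 2⌉₊, |c k|, fun n hn0 t ht => ?_⟩
  have hsn : 0 < √(n : ℝ) := by positivity
  rcases le_or_gt (K / √n) δ with h | h
  · have hs : s ≤ t := gaussQ_strictAnti.le_iff_ge.1 (by
      have : 0 ≤ K / √n := by positivity
      linarith)
    have ht1 : t ≤ s + 1 := gaussQ_strictAnti.le_iff_ge.1 (by
      rw [ht]
      linarith)
    have h1 := mul_sub_le_gaussQ_sub hs ht1
    rw [ht, sub_sub_cancel, ← hd', le_div_iff₀ hsn] at h1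
    have : (t - s) * √n ≤ K / d := by
      rw [le_div_iff₀ hd]
      linarith
    linarith
  · have hmem : n ∈ Finset.range ⌈(K / δ) ^ 2⌉₊ := by
      rw [Finset.mem_range, Nat.lt_ceil]
      rw [lt_div_comm₀ hδ hsn] at h
      have := pow_lt_pow_left₀ h hsn.le two_ne_zero
      rwa [sq_sqrt (by positivity)] at this
    have h1 := Finset.single_le_sum (f := fun k => |c k|) (fun _ _ => abs_nonneg _) hmem
    have h2 := (hc n t ht).trans (le_abs_self _)
    have : 0 ≤ K / d := by positivity
    linarith

section ConfidenceSet

variable {X Y : Type*} [Fintype Y] {P : X → Y → ℝ}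

theorem lt_of_prod_div_lt {n : ℕ} (hn : 0 < n) (hPnonneg : ∀ x y, 0 ≤ P x y) {H σ t : ℝ}
    (hσ : 0 < σ) {f : Fin n → X × Y} (hf : ∏ i, P (f i).1 (f i).2 ≠ 0)
    (h : ∏ i, P (f i).1 (f i).2 / ∑ y', P (f i).1 y' < rexp (n * (-H) - t * σ * √n)) :
    t < (∑ i, -(log (P (f i).1 (f i).2 / ∑ y', P (f i).1 y') + H) / σ) / √n := by
  have hpos : ∀ i, 0 < P (f i).1 (f i).2 / ∑ y', P (f i).1 y' := fun i => by
    have h0 : 0 < P (f i).1 (f i).2 :=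
      (hPnonneg _ _).lt_of_ne' (Finset.prod_ne_zero_iff.1 hf i (Finset.mem_univ i))
    exact div_pos h0 (h0.trans_le (Finset.single_le_sum (f := fun y' => P (f i).1 y')
      (fun y' _ => hPnonneg _ y') (Finset.mem_univ _)))
  rw [← log_lt_iff_lt_exp (Finset.prod_pos fun i _ => hpos i),
    log_prod fun i _ => (hpos i).ne'] at h
  rw [lt_div_iff₀ (by positivity), ← Finset.sum_div, lt_div_iff₀ hσ, Finset.sum_neg_distrib,
    Finset.sum_add_distrib]
  simp only [Finset.sum_const, Finset.card_univ, Fintype.card_fin, nsmul_eq_mul]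
  linarith

variable [Fintype X]

theorem sum_sum_eq_sum_pi_prod {n : ℕ} (g : (Fin n → X) → (Fin n → Y) → ℝ) :
    ∑ xs, ∑ ys, g xs ys = ∑ f : Fin n → X × Y, g (fun i => (f i).1) fun i => (f i).2 := by
  rw [← Fintype.sum_prod_type', ← (Equiv.arrowProdEquivProdArrow (Fin n) (fun _ => X)
    fun _ => Y).sum_comp]
  rfl

theorem sum_sum_prod_eq_one (hPsum : ∑ x, ∑ y, P x y = 1) (n : ℕ) :
    ∑ xs : Fin n → X, ∑ ys : Fin n → Y, ∏ i, P (xs i) (ys i) = 1 := by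
  rw [sum_sum_eq_sum_pi_prod fun xs ys => ∏ i, P (xs i) (ys i)]
  exact sum_prod_eq_one (q := fun a : X × Y => P a.1 a.2)
    (by rw [Fintype.sum_prod_type]; exact hPsum) n

theorem sum_prod_mul_card_mul_le_one (hPnonneg : ∀ x y, 0 ≤ P x y)
    (hPsum : ∑ x, ∑ y, P x y = 1) {n : ℕ} {β : ℝ} {Γ : (Fin n → X) → Finset (Fin n → Y)}
    (hΓ : ∀ xs, ∀ ys ∈ Γ xs, β ≤ ∏ i, P (xs i) (ys i) / ∑ y', P (xs i) y') :
    (∑ xs : Fin n → X, (∏ i, ∑ y, P (xs i) y) * ((Γ xs).card : ℝ)) * β ≤ 1 := by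
  rw [← sum_sum_prod_eq_one hPsum n, Finset.sum_mul]
  refine Finset.sum_le_sum fun xs _ => ?_
  have hPX : ∀ x, 0 ≤ ∑ y, P x y := fun x => Finset.sum_nonneg fun y _ => hPnonneg x y
  calc (∏ i, ∑ y, P (xs i) y) * ((Γ xs).card : ℝ) * β
      = (∏ i, ∑ y, P (xs i) y) * ∑ ys ∈ Γ xs, β := by
        rw [Finset.sum_const, nsmul_eq_mul, mul_assoc]
    _ ≤ (∏ i, ∑ y, P (xs i) y) * ∑ ys ∈ Γ xs, (∏ i, P (xs i) (ys i) / ∑ y', P (xs i) y') :=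
        mul_le_mul_of_nonneg_left (Finset.sum_le_sum (hΓ xs))
          (Finset.prod_nonneg fun i _ => hPX _)
    _ ≤ ∑ ys ∈ Γ xs, ∏ i, P (xs i) (ys i) := by
        rw [Finset.mul_sum]
        refine Finset.sum_le_sum fun ys _ => ?_
        rw [← Finset.prod_mul_distrib]
        refine Finset.prod_le_prod (fun i _ => mul_nonneg (hPX _)
          (div_nonneg (hPnonneg _ _) (hPX _))) fun i _ => ?_
        rcases eq_or_ne (∑ y', P (xs i) y') 0 with h0 | h0
        · simpa [h0] using hPnonneg _ _
        · rw [mul_div_cancel₀ _ h0]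
    _ ≤ ∑ ys : Fin n → Y, ∏ i, P (xs i) (ys i) :=
        Finset.sum_le_sum_of_subset_of_nonneg (Finset.subset_univ _) fun ys _ _ =>
          Finset.prod_nonneg fun i _ => hPnonneg _ _

variable [DecidableEq Y]

theorem sum_sum_prod_mul_ite_mem_le (hPnonneg : ∀ x y, 0 ≤ P x y) (hPsum : ∑ x, ∑ y, P x y = 1)
    {H σ ρ : ℝ} (hH : H = -∑ x, ∑ y, P x y * log (P x y / ∑ y', P x y'))
    (hσ : σ ^ 2 = ∑ x, ∑ y, P x y * (log (P x y / ∑ y', P x y') + H) ^ 2) (hσpos : 0 < σ)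
    (hρ : ρ = ∑ x, ∑ y, P x y * |log (P x y / ∑ y', P x y') + H| ^ 3) {n : ℕ} (hn : 0 < n)
    (t : ℝ) {Γ : (Fin n → X) → Finset (Fin n → Y)}
    (hΓ : ∀ xs ys, ys ∈ Γ xs ↔ rexp (n * (-H) - t * σ * √n) ≤
      ∏ i, P (xs i) (ys i) / ∑ y', P (xs i) y') :
    ∑ xs : Fin n → X, ∑ ys : Fin n → Y, (∏ i, P (xs i) (ys i)) * (if ys ∈ Γ xs then 0 else 1) ≤
      gaussQ t + ρ / (√n * σ ^ 3) := by
  set q : X × Y → ℝ := fun a => P a.1 a.2 with hq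
  set z : X × Y → ℝ := fun a => -(log (P a.1 a.2 / ∑ y', P a.1 y') + H) / σ with hz
  have hq1 : ∑ a, q a = 1 := by
    rw [Fintype.sum_prod_type]
    exact hPsum
  have hz1 : ∑ a, q a * z a = 0 := by
    have e : ∀ a, q a * z a =
        -(q a * log (P a.1 a.2 / ∑ y', P a.1 y')) / σ - H / σ * q a := fun a => by
      simp only [hz]
      ring
    simp only [e, Finset.sum_sub_distrib, ← Finset.sum_div, Finset.sum_neg_distrib,
      ← Finset.mul_sum, hq1]
    rw [Fintype.sum_prod_type, ← hH]
    ring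
  have hz2 : ∑ a, q a * z a ^ 2 = 1 := by
    have e : ∀ a, q a * z a ^ 2 =
        q a * (log (P a.1 a.2 / ∑ y', P a.1 y') + H) ^ 2 / σ ^ 2 := fun a => by
      simp only [hz]
      ring
    simp only [e, ← Finset.sum_div]
    rw [Fintype.sum_prod_type, ← hσ, div_self (by positivity)]
  have hz3 : ∑ a, q a * |z a| ^ 3 = ρ / σ ^ 3 := by
    have e : ∀ a, q a * |z a| ^ 3 =
        q a * |log (P a.1 a.2 / ∑ y', P a.1 y') + H| ^ 3 / σ ^ 3 := fun a => by
      simp only [hz, abs_div, abs_neg, abs_of_pos hσpos]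
      ring
    simp only [e, ← Finset.sum_div]
    rw [Fintype.sum_prod_type, hρ]
  have h := sum_prod_ite_lt_le_gaussQ_add (q := q) (z := z) (fun a => hPnonneg _ _) hq1 hz1 hz2
    hn t
  rw [hz3, div_div, mul_comm (σ ^ 3)] at h
  refine le_trans ?_ h
  rw [sum_sum_eq_sum_pi_prod fun xs ys => (∏ i, P (xs i) (ys i)) * (if ys ∈ Γ xs then 0 else 1)]
  refine Finset.sum_le_sum fun f _ => ?_
  by_cases hf : ∏ i, P (f i).1 (f i).2 = 0
  · simp [hq, hf]
  refine mul_le_mul_of_nonneg_left ?_ (Finset.prod_nonneg fun i _ => hPnonneg _ _)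
  by_cases hm : (fun i => (f i).2) ∈ Γ fun i => (f i).1
  · rw [if_pos hm]
    split_ifs <;> norm_num
  · rw [hΓ, not_le] at hm
    rw [if_pos (lt_of_prod_div_lt hn hPnonneg hσpos hf hm)]
    split_ifs <;> norm_num

theorem one_sub_le_sum_prod_mul_card (hPnonneg : ∀ x y, 0 ≤ P x y)
    (hPsum : ∑ x, ∑ y, P x y = 1) {n : ℕ} (Γ : (Fin n → X) → Finset (Fin n → Y)) :
    1 - ∑ xs : Fin n → X, ∑ ys : Fin n → Y,
        (∏ i, P (xs i) (ys i)) * (if ys ∈ Γ xs then 0 else 1) ≤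
      ∑ xs : Fin n → X, (∏ i, ∑ y, P (xs i) y) * ((Γ xs).card : ℝ) := by
  nth_rw 1 [← sum_sum_prod_eq_one hPsum n]
  rw [← Finset.sum_sub_distrib]
  refine Finset.sum_le_sum fun xs _ => ?_
  calc ∑ ys : Fin n → Y, ∏ i, P (xs i) (ys i) -
        ∑ ys : Fin n → Y, (∏ i, P (xs i) (ys i)) * (if ys ∈ Γ xs then 0 else 1)
      = ∑ ys ∈ Γ xs, ∏ i, P (xs i) (ys i) := by
        rw [← Finset.sum_sub_distrib, ← Finset.univ_inter (Γ xs), ← Finset.sum_ite_mem]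
        refine Finset.sum_congr rfl fun ys _ => ?_
        by_cases h : ys ∈ Γ xs <;> simp [h]
    _ ≤ ∑ ys ∈ Γ xs, ∏ i, ∑ y, P (xs i) y := Finset.sum_le_sum fun ys _ =>
        Finset.prod_le_prod (fun i _ => hPnonneg _ _) fun i _ =>
          Finset.single_le_sum (f := fun y => P (xs i) y) (fun y _ => hPnonneg _ y)
            (Finset.mem_univ _)
    _ = _ := by rw [Finset.sum_const, nsmul_eq_mul, mul_comm]

end ConfidenceSet

end BerryEsseen

/-- **achievability.** Let `(X_i,Y_i)` be i.i.d. from a finite joint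
distribution with conditional entropy `H`, dispersion `σ > 0`, third moment `ρ`, and let
`s = Q⁻¹(α)`. There is a constant `C` such that for every `n > 0` and every
`t = Q⁻¹(α − ρ/(√n σ³))` (i.e. `gaussQ t = α − ρ/(√n σ³)`, which forces this value to
lie in `(0,1)`), the confidence set
`Γ(x₁ⁿ) = {(y₁,…,y_n) : ∏ᵢ P(yᵢ|xᵢ) ≥ β}` with `β = exp(nμ − t·σ·√n)`, `μ = −H`,
has error probability at most `α` and efficiency
`(1/n)·log E[|Γ(X₁ⁿ)|] ≤ H + σ·Q⁻¹(α)/√n + C/n`. -/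
theorem achievability_of_nonasymptotic_bound
    {X Y : Type*} [Fintype X] [Fintype Y] [DecidableEq Y]
    (P : X → Y → ℝ) (hPnonneg : ∀ x y, 0 ≤ P x y)
    (hPsum : ∑ x, ∑ y, P x y = 1)
    (H σ ρ : ℝ)
    (hH : H = -∑ x, ∑ y, P x y * Real.log (P x y / ∑ y', P x y'))
    (hσ : σ ^ 2 = ∑ x, ∑ y, P x y * (Real.log (P x y / ∑ y', P x y') + H) ^ 2)
    (hσpos : 0 < σ)
    (hρ : ρ = ∑ x, ∑ y, P x y * |Real.log (P x y / ∑ y', P x y') + H| ^ 3)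
    (α s : ℝ) (hs : gaussQ s = α) :
    ∃ C : ℝ, ∀ n : ℕ, 0 < n → ∀ t : ℝ,
      gaussQ t = α - ρ / (Real.sqrt n * σ ^ 3) →
      ∀ Γ : (Fin n → X) → Finset (Fin n → Y),
        (∀ xs ys, ys ∈ Γ xs ↔
          Real.exp ((n : ℝ) * (-H) - t * σ * Real.sqrt n) ≤
            ∏ i, P (xs i) (ys i) / ∑ y', P (xs i) y') →
        (∑ xs : Fin n → X, ∑ ys : Fin n → Y,
            (∏ i, P (xs i) (ys i)) * (if ys ∈ Γ xs then 0 else 1) ≤ α) ∧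
        Real.log (∑ xs : Fin n → X, (∏ i, ∑ y, P (xs i) y) * ((Γ xs).card : ℝ)) / n ≤
          H + σ * s / Real.sqrt n + C / n := by
  subst hs
  have hρ0 : 0 ≤ ρ := hρ ▸ Finset.sum_nonneg fun x _ => Finset.sum_nonneg fun y _ =>
    mul_nonneg (hPnonneg x y) (by positivity)
  obtain ⟨C, hC⟩ := exists_forall_sub_mul_sqrt_le (s := s)
    (by positivity : 0 ≤ ρ / σ ^ 3)
  refine ⟨σ * C, fun n hn t ht Γ hΓ => ?_⟩
  have herr := sum_sum_prod_mul_ite_mem_le hPnonneg hPsum hH hσ hσpos hρ hn t hΓ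
  rw [ht, sub_add_cancel] at herr
  refine ⟨herr, ?_⟩
  have hn' : (0 : ℝ) < n := by exact_mod_cast hn
  have hsn : 0 < Real.sqrt n := Real.sqrt_pos.2 hn'
  have hss : Real.sqrt n * Real.sqrt n = n := Real.mul_self_sqrt hn'.le
  have hlow := one_sub_le_sum_prod_mul_card hPnonneg hPsum Γ
  have hup := sum_prod_mul_card_mul_le_one hPnonneg hPsum fun xs ys => (hΓ xs ys).1
  set E := ∑ xs : Fin n → X, (∏ i, ∑ y, P (xs i) y) * ((Γ xs).card : ℝ)
  have hE : 0 < E := by linarith [gaussQ_lt_one s]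
  have hlog : Real.log E + ((n : ℝ) * (-H) - t * σ * Real.sqrt n) ≤ 0 := by
    rw [← Real.log_exp ((n : ℝ) * (-H) - t * σ * Real.sqrt n),
      ← Real.log_mul hE.ne' (Real.exp_pos _).ne']
    exact Real.log_nonpos (by positivity) hup
  have hCt := hC n hn t (by rw [ht, div_div, mul_comm (σ ^ 3)])
  have e : H + σ * s / Real.sqrt n + σ * C / n =
      (H * n + σ * s * Real.sqrt n + σ * C) / n := by
    rw [add_div, add_div, mul_div_cancel_right₀ _ hn'.ne', add_left_inj, add_right_inj,
      div_eq_div_iff hsn.ne' hn'.ne', mul_assoc (σ * s), hss]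
  rw [e]
  gcongr
  linarith [mul_le_mul_of_nonneg_left hCt hσpos.le]
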